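/- arXiv:2505.02653 — 8 statements merged into one kernel-verified Lean document; each statement's English description precedes it below -/
import Mathlib

section
/- Let d ≥ 2. For i = 1, 2, let ψ^{(i)} and ψ₀^{(i)} be continuous, strictly increasing bijections from [0,∞) onto [0,∞) (in particular ψ^{(i)}(0) = ψ₀^{(i)}(0) = 0). If for every (λ₁,…,λ_d) ∈ [0,∞)^d one has ψ₀^{(1)}(∑_{j=1}^d ψ^{(1)}(λ_j)) = ψ₀^{(2)}(∑_{j=1}^d ψ^{(2)}(λ_j)), then there exists a constant c > 0 such that for all s ≥ 0: ψ^{(2)}(s) = ψ^{(1)}(s)/c and ψ₀^{(2)}(s) = ψ₀^{(1)}(c s). -/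
/-- A Laplace-exponent-like function: a continuous, strictly increasing
bijection from `[0,∞)` onto `[0,∞)` (in particular vanishing at `0`). -/
def IsLaplaceExponentLike (ψ : ℝ → ℝ) : Prop :=
  ContinuousOn ψ (Set.Ici 0) ∧ StrictMonoOn ψ (Set.Ici 0) ∧
    Set.BijOn ψ (Set.Ici 0) (Set.Ici 0) ∧ ψ 0 = 0

/-- Identifiability of hierarchical Laplace exponents: if the two
composed exponents `ψ₀⁽ⁱ⁾(∑ⱼ ψ⁽ⁱ⁾(λⱼ))` coincide on `[0,∞)^d` (`d ≥ 2`), then there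
is a constant `c > 0` with `ψ⁽²⁾ = ψ⁽¹⁾/c` and `ψ₀⁽²⁾(s) = ψ₀⁽¹⁾(cs)` on `[0,∞)`. -/
theorem hierarchical_laplace_identifiability
    (d : ℕ) (hd : 2 ≤ d)
    (ψ₁ ψ₂ ψ₀₁ ψ₀₂ : ℝ → ℝ)
    (hψ₁ : IsLaplaceExponentLike ψ₁) (hψ₂ : IsLaplaceExponentLike ψ₂)
    (hψ₀₁ : IsLaplaceExponentLike ψ₀₁) (hψ₀₂ : IsLaplaceExponentLike ψ₀₂)
    (heq : ∀ lam : Fin d → ℝ, (∀ j, 0 ≤ lam j) →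
      ψ₀₁ (∑ j, ψ₁ (lam j)) = ψ₀₂ (∑ j, ψ₂ (lam j))) :
    ∃ c : ℝ, 0 < c ∧ ∀ s : ℝ, 0 ≤ s →
      ψ₂ s = ψ₁ s / c ∧ ψ₀₂ s = ψ₀₁ (c * s) := by
  obtain ⟨n, rfl⟩ : ∃ n, d = n + 2 := ⟨d - 2, by omega⟩
  obtain ⟨-, hm1, hb1, h10⟩ := hψ₁
  obtain ⟨-, hm2, hb2, h20⟩ := hψ₂
  obtain ⟨-, hm01, hb01, h010⟩ := hψ₀₁
  have two : ∀ a b : ℝ, 0 ≤ a → 0 ≤ b → ψ₀₁ (ψ₁ a + ψ₁ b) = ψ₀₂ (ψ₂ a + ψ₂ b) := by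
    intro a b ha hb
    have h := heq (Fin.cons a (Fin.cons b (fun _ => 0))) (by
      intro j
      refine Fin.cases ?_ (fun j => ?_) j
      · simpa using ha
      · refine Fin.cases ?_ (fun j => ?_) j
        · simpa using hb
        · simp)
    simpa [Fin.sum_univ_succ, h10, h20] using h
  have hsurj : ∀ u : ℝ, ∃ x : ℝ, 0 ≤ u → 0 ≤ x ∧ ψ₂ x = u := by
    intro u
    by_cases hu : 0 ≤ u
    · obtain ⟨x, hx, hxu⟩ := hb2.surjOn hu
      exact ⟨x, fun _ => ⟨hx, hxu⟩⟩
    · exact ⟨0, fun h => absurd h hu⟩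
  choose g hg using hsurj
  obtain ⟨h, hh⟩ : ∃ h : ℝ → ℝ, ∀ u, h u = ψ₁ (g u) := ⟨_, fun _ => rfl⟩
  have hn : ∀ u, 0 ≤ u → 0 ≤ h u := fun u hu => by
    rw [hh]; exact hb1.mapsTo (hg u hu).1
  have hψ : ∀ s, 0 ≤ s → h (ψ₂ s) = ψ₁ s := by
    intro s hs
    have hp : 0 ≤ ψ₂ s := hb2.mapsTo hs
    rw [hh, hb2.injOn (hg _ hp).1 hs (hg _ hp).2]
  have h0 : h 0 = 0 := by
    have := hψ 0 le_rfl
    rwa [h20, h10] at this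
  have key : ∀ u v, 0 ≤ u → 0 ≤ v → ψ₀₁ (h u + h v) = ψ₀₂ (u + v) := by
    intro u v hu hv
    have := two (g u) (g v) (hg u hu).1 (hg v hv).1
    rwa [(hg u hu).2, (hg v hv).2, ← hh, ← hh] at this
  have hadd : ∀ u v, 0 ≤ u → 0 ≤ v → h (u + v) = h u + h v := by
    intro u v hu hv
    have k1 := key u v hu hv
    have k2 := key (u + v) 0 (add_nonneg hu hv) le_rfl
    rw [h0, add_zero, add_zero] at k2
    exact hb01.injOn (hn _ (add_nonneg hu hv)) (add_nonneg (hn u hu) (hn v hv)) (k2.trans k1.symm)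
  let H : ℝ →+ ℝ := AddMonoidHom.mk' (fun x => h (max x 0) - h (max (-x) 0)) (by
    intro x y
    have e : ∀ z : ℝ, max z 0 - max (-z) 0 = z := by
      intro z
      rcases le_total z 0 with hz | hz
      · rw [max_eq_right hz, max_eq_left (by linarith)]; ring
      · rw [max_eq_left hz, max_eq_right (by linarith)]; ring
    have p : ∀ z : ℝ, 0 ≤ max z 0 := fun z => le_max_right _ _
    have E : max (x + y) 0 + (max (-x) 0 + max (-y) 0)
        = max (-(x + y)) 0 + (max x 0 + max y 0) := by
      linarith [e x, e y, e (x + y)]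
    have E2 := congrArg h E
    rw [hadd _ _ (p _) (add_nonneg (p _) (p _)), hadd _ _ (p _) (p _),
      hadd _ _ (p _) (add_nonneg (p _) (p _)), hadd _ _ (p _) (p _)] at E2
    linarith)
  have Hh : ∀ x, 0 ≤ x → H x = h x := by
    intro x hx
    change h (max x 0) - h (max (-x) 0) = h x
    rw [max_eq_left hx, max_eq_right (by linarith), h0, sub_zero]
  have Hmono : Monotone H := by
    intro x y hxy
    have h1 := Hh (y - x) (sub_nonneg.2 hxy)
    have h2 := hn (y - x) (sub_nonneg.2 hxy)
    rw [map_sub] at h1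
    linarith
  have Hcont : Continuous H := MeasureTheory.Measure.AddMonoidHom.continuous_of_measurable H Hmono.measurable
  have hlin : ∀ u, 0 ≤ u → h u = h 1 * u := by
    intro u hu
    have := map_real_smul H Hcont u 1
    rw [smul_eq_mul, smul_eq_mul, mul_one, Hh u hu, Hh 1 zero_le_one] at this
    rw [this, mul_comm]
  have hc : 0 < h 1 := by
    refine lt_of_le_of_ne (hn 1 zero_le_one) fun hz => ?_
    have h1 := hm1 (Set.mem_Ici.2 le_rfl) (Set.mem_Ici.2 zero_le_one) (zero_lt_one (α := ℝ))
    have h2 := hlin (ψ₂ 1) (hb2.mapsTo (Set.mem_Ici.2 zero_le_one))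
    rw [hψ 1 zero_le_one, ← hz, zero_mul] at h2
    linarith
  refine ⟨h 1, hc, fun s hs => ⟨?_, ?_⟩⟩
  · rw [← hψ s hs, hlin (ψ₂ s) (hb2.mapsTo hs)]
    field_simp
  · have := key s 0 hs le_rfl
    rw [h0, add_zero, add_zero, hlin s hs] at this
    exact this.symm
end

section
/- Fix α > 0 and b > 0, and let γ_{a,b}(s) = b^a Γ(a)^{-1} s^{a−1} e^{−bs} for s > 0 denote the density of the gamma distribution with shape a > 0 and rate b. Then there do not exist real numbers 0 < t₁ < t₂ and a function H : (0,∞) → ℝ such that for all s > 0 and for both i = 1, 2 one has γ_{α t_i, b}(s) = H(s/t_i)/t_i. -/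
/-- The density of the gamma distribution with shape `a > 0` and rate `b > 0`:
`γ_{a,b}(s) = b^a Γ(a)⁻¹ s^{a-1} e^{-bs}` for `s > 0`. -/
noncomputable def gammaDensity (a b s : ℝ) : ℝ :=
  b ^ a / Real.Gamma a * s ^ (a - 1) * Real.exp (-(b * s))

/-- Logarithm of the gamma density at a positive point. -/
lemma log_gammaDensity (a b s : ℝ) (ha : 0 < a) (hb : 0 < b) (hs : 0 < s) :
    Real.log (gammaDensity a b s) =
      Real.log (b ^ a / Real.Gamma a) + (a - 1) * Real.log s - b * s := by
  have hG := Real.Gamma_pos_of_pos ha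
  have h1 : 0 < b ^ a := Real.rpow_pos_of_pos hb a
  have h2 : 0 < s ^ (a - 1) := Real.rpow_pos_of_pos hs _
  have h3 : 0 < b ^ a / Real.Gamma a := div_pos h1 hG
  unfold gammaDensity
  rw [Real.log_mul (mul_pos h3 h2).ne' (Real.exp_pos _).ne', Real.log_mul h3.ne' h2.ne',
    Real.log_exp, Real.log_rpow hs]
  ring

/-- Logarithm of `H` when the gamma density with shape `α t` is `H (s / t) / t`. -/
lemma log_H_eq (α b t : ℝ) (H : ℝ → ℝ) (hα : 0 < α) (hb : 0 < b) (ht : 0 < t)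
    (h : ∀ s : ℝ, 0 < s → gammaDensity (α * t) b s = H (s / t) / t) (u : ℝ) (hu : 0 < u) :
    Real.log (H u / t) = Real.log (b ^ (α * t) / Real.Gamma (α * t))
      + (α * t - 1) * (Real.log t + Real.log u) - b * (t * u) := by
  have h1 := h (t * u) (mul_pos ht hu)
  rw [mul_div_cancel_left₀ u ht.ne'] at h1
  rw [← h1, log_gammaDensity _ _ _ (mul_pos hα ht) hb (mul_pos ht hu),
    Real.log_mul ht.ne' hu.ne']

/-- (Gamma instance of Lemma 1.) There are no `0 < t₁ < t₂` and
`H : (0,∞) → ℝ` such that `γ_{α tᵢ, b}(s) = H(s/tᵢ)/tᵢ` for all `s > 0` and `i = 1, 2`. -/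
theorem gamma_not_scale_mixture (α b : ℝ) (hα : 0 < α) (hb : 0 < b) :
    ¬ ∃ (t₁ t₂ : ℝ) (H : ℝ → ℝ), 0 < t₁ ∧ t₁ < t₂ ∧
      (∀ s : ℝ, 0 < s → gammaDensity (α * t₁) b s = H (s / t₁) / t₁) ∧
      (∀ s : ℝ, 0 < s → gammaDensity (α * t₂) b s = H (s / t₂) / t₂) := by
  rintro ⟨t₁, t₂, H, h0, h12, h1, h2⟩
  have h0' : 0 < t₂ := h0.trans h12
  have hne : ∀ u : ℝ, 0 < u → H u ≠ 0 := by
    intro u hu hz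
    have e := h1 (t₁ * u) (mul_pos h0 hu)
    rw [mul_div_cancel_left₀ u h0.ne', hz, zero_div] at e
    have hG := Real.Gamma_pos_of_pos (mul_pos hα h0)
    have : 0 < gammaDensity (α * t₁) b (t₁ * u) := by
      unfold gammaDensity
      positivity
    exact this.ne' e
  have key : ∀ u : ℝ, 0 < u → _ := fun u hu => log_H_eq α b t₁ H hα hb h0 h1 u hu
  have key2 : ∀ u : ℝ, 0 < u → _ := fun u hu => log_H_eq α b t₂ H hα hb h0' h2 u hu
  have l4 : Real.log 4 = 2 * Real.log 2 := by
    rw [show (4 : ℝ) = 2 ^ 2 by norm_num, Real.log_pow]; norm_num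
  have a1 := key 1 (by norm_num)
  have a2 := key 2 (by norm_num)
  have a4 := key 4 (by norm_num)
  have b1 := key2 1 (by norm_num)
  have b2 := key2 2 (by norm_num)
  have b4 := key2 4 (by norm_num)
  rw [Real.log_div (hne _ (by norm_num)) h0.ne'] at a1 a2 a4
  rw [Real.log_div (hne _ (by norm_num)) h0'.ne'] at b1 b2 b4
  rw [l4] at a4 b4
  rw [Real.log_one] at a1 b1
  have : b * (t₂ - t₁) = 0 := by linarith
  exact (mul_pos hb (sub_pos.mpr h12)).ne' this
end

section
/- Let ρ and ρ₀ be σ-finite Borel measures on (0,∞) with ∫ min(s,1) dρ(s) < ∞ and ∫ min(t,1) dρ₀(t) < ∞. Set ψ(λ) = ∫ (1 − e^{−λs}) dρ(s) for λ ≥ 0. For each t > 0, let ν_t be a probability measure on [0,∞) with ∫ e^{−λs} dν_t(s) = e^{−t ψ(λ)} for all λ ≥ 0, and assume t ↦ ν_t(B) is measurable for each Borel set B. Define the measure ρ₁ on (0,∞) by ρ₁(B) = ∫_0^∞ ν_t(B ∩ (0,∞)) dρ₀(t). Then ρ₁((0,∞)) = ∞ if and only if both ρ((0,∞)) = ∞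 and ρ₀((0,∞)) = ∞. -/
open MeasureTheory

lemma aux_pos (ρ : Measure ℝ) (h : ρ (Set.Iic 0) = 0) : ∀ᵐ s ∂ρ, 0 < s := by
  rw [ae_iff]
  simpa [Set.Iic] using h

lemma aux_integrable (ρ : Measure ℝ) (h : ρ (Set.Iic 0) = 0)
    (hρint : ∫⁻ s, ENNReal.ofReal (min s 1) ∂ρ < ⊤) (l : ℝ) (hl : 0 ≤ l) :
    Integrable (fun s => 1 - Real.exp (-(l * s))) ρ := by
  have hpos := aux_pos ρ h
  have hm : Integrable (fun s : ℝ => min s 1) ρ := by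
    refine ⟨by fun_prop, ?_⟩
    rw [hasFiniteIntegral_iff_ofReal]
    · exact hρint
    · filter_upwards [hpos] with s hs
      exact le_min hs.le zero_le_one
  refine (hm.const_mul (l + 1)).mono' (by fun_prop) ?_
  filter_upwards [hpos] with s hs
  have h1 : Real.exp (-(l * s)) ≤ 1 := Real.exp_le_one_iff.2 (by nlinarith)
  have h2 := Real.add_one_le_exp (-(l * s))
  have h3 := Real.exp_pos (-(l * s))
  rw [Real.norm_eq_abs, abs_of_nonneg (by linarith)]
  rcases min_cases s 1 with ⟨h, _⟩ | ⟨h, _⟩ <;> rw [h] <;> nlinarith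

lemma aux_markov (μ : Measure ℝ) (K : ENNReal)
    (h : ∀ n : ℕ, ∫⁻ s, ENNReal.ofReal (1 - Real.exp (-((n:ℝ) * s))) ∂μ ≤ K) :
    ENNReal.ofReal (1 - Real.exp (-1)) * μ (Set.Ioi 0) ≤ K := by
  have hU : Set.Ioi (0:ℝ) = ⋃ n : ℕ, {s : ℝ | 1 ≤ (n:ℝ) * s} := by
    ext s
    simp only [Set.mem_Ioi, Set.mem_iUnion, Set.mem_setOf_eq]
    constructor
    · intro hs
      obtain ⟨n, hn⟩ := exists_nat_ge (1 / s)
      exact ⟨n, (div_le_iff₀ hs).1 hn⟩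
    · rintro ⟨n, hn⟩
      by_contra hs
      have : (n:ℝ) * s ≤ 0 := mul_nonpos_of_nonneg_of_nonpos (Nat.cast_nonneg n) (not_lt.1 hs)
      linarith
  have hmono : Monotone fun n : ℕ => {s : ℝ | 1 ≤ (n:ℝ) * s} := by
    intro m n hmn s hs
    simp only [Set.mem_setOf_eq] at hs ⊢
    have hmn' : (m:ℝ) ≤ n := Nat.cast_le.2 hmn
    have hs0 : 0 ≤ s := by
      by_contra hs0
      have : (m:ℝ) * s ≤ 0 :=
        mul_nonpos_of_nonneg_of_nonpos (Nat.cast_nonneg m) (not_le.1 hs0).le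
      linarith
    nlinarith
  rw [hU, hmono.measure_iUnion, ENNReal.mul_iSup]
  refine iSup_le fun n => le_trans ?_ (h n)
  refine le_trans ?_ (mul_meas_ge_le_lintegral (by fun_prop) (ENNReal.ofReal (1 - Real.exp (-1))))
  refine mul_le_mul_right (measure_mono ?_) _
  intro s hs
  have hs : 1 ≤ (n:ℝ) * s := hs
  show ENNReal.ofReal (1 - Real.exp (-1)) ≤ ENNReal.ofReal (1 - Real.exp (-((n:ℝ) * s)))
  apply ENNReal.ofReal_le_ofReal
  have : Real.exp (-((n:ℝ) * s)) ≤ Real.exp (-1) := Real.exp_le_exp.2 (by simpa using hs)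
  linarith

/-- (Lemma 2: infinite activity of the marginal Lévy measure.)
With `ρ` the idiosyncratic Lévy measure, `ρ₀` the base Lévy measure, `ν t` the
infinitely divisible law with Laplace transform `e^{-tψ(λ)}`, and
`ρ₁(B) = ∫ ν_t(B ∩ (0,∞)) dρ₀(t)`, one has `ρ₁((0,∞)) = ∞` iff both
`ρ((0,∞)) = ∞` and `ρ₀((0,∞)) = ∞`. -/
theorem marginal_levy_infinite_activity
    (ρ ρ₀ : Measure ℝ) [SigmaFinite ρ] [SigmaFinite ρ₀]
    (hρsupp : ρ (Set.Iic 0) = 0) (hρ₀supp : ρ₀ (Set.Iic 0) = 0)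
    (hρint : ∫⁻ s, ENNReal.ofReal (min s 1) ∂ρ < ⊤)
    (hρ₀int : ∫⁻ t, ENNReal.ofReal (min t 1) ∂ρ₀ < ⊤)
    (ψ : ℝ → ℝ)
    (hψ : ∀ l : ℝ, 0 ≤ l → ψ l = ∫ s, (1 - Real.exp (-(l * s))) ∂ρ)
    (ν : ℝ → Measure ℝ)
    (hνprob : ∀ t, 0 < t → IsProbabilityMeasure (ν t))
    (hνsupp : ∀ t, 0 < t → ν t (Set.Iio 0) = 0)
    (hνlap : ∀ t, 0 < t → ∀ l : ℝ, 0 ≤ l →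
      ∫ s, Real.exp (-(l * s)) ∂(ν t) = Real.exp (-(t * ψ l)))
    (hνmeas : ∀ B : Set ℝ, MeasurableSet B → Measurable fun t => ν t B)
    (ρ₁ : Measure ℝ)
    (hρ₁ : ∀ B : Set ℝ, MeasurableSet B →
      ρ₁ B = ∫⁻ t in Set.Ioi (0:ℝ), ν t (B ∩ Set.Ioi 0) ∂ρ₀) :
    ρ₁ (Set.Ioi 0) = ⊤ ↔ (ρ (Set.Ioi 0) = ⊤ ∧ ρ₀ (Set.Ioi 0) = ⊤) := by
  
  have hi : ∀ l : ℝ, 0 ≤ l → Integrable (fun s => 1 - Real.exp (-(l * s))) ρ :=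
    fun l hl => aux_integrable ρ hρsupp hρint l hl
  have hpos : ∀ᵐ s ∂ρ, 0 < s := aux_pos ρ hρsupp
  have hψof : ∀ l : ℝ, 0 ≤ l →
      ∫⁻ s, ENNReal.ofReal (1 - Real.exp (-(l * s))) ∂ρ = ENNReal.ofReal (ψ l) := by
    intro l hl
    rw [hψ l hl, ofReal_integral_eq_lintegral_ofReal (hi l hl)]
    filter_upwards [hpos] with s hs
    have : Real.exp (-(l * s)) ≤ 1 := Real.exp_le_one_iff.2 (by nlinarith)
    simpa using this
  have h1 : ρ₁ (Set.Ioi 0) = ∫⁻ t in Set.Ioi (0:ℝ), ν t (Set.Ioi 0) ∂ρ₀ := by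
    rw [hρ₁ _ measurableSet_Ioi, Set.inter_self]
  have hc : 0 < 1 - Real.exp (-1) := by
    have : Real.exp (-1) < 1 := by rw [← Real.exp_zero]; exact Real.exp_lt_exp.2 (by norm_num)
    linarith
  have hc0 : ENNReal.ofReal (1 - Real.exp (-1)) ≠ 0 := by simpa using hc
  have hνi : ∀ t, 0 < t → ∀ l : ℝ, 0 ≤ l → Integrable (fun s => Real.exp (-(l * s))) (ν t) := by
    intro t ht l hl
    by_contra h
    have h2 := hνlap t ht l hl
    rw [integral_undef h] at h2
    exact (Real.exp_pos _).ne h2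
  by_cases hinf : ρ (Set.Ioi 0) = ⊤
  · have hone : ∀ t ∈ Set.Ioi (0:ℝ), ν t (Set.Ioi 0) = 1 := by
      intro t ht
      have ht : 0 < t := ht
      haveI := hνprob t ht
      have hz : ν t {0} = 0 := by
        by_contra hne
        have hp : 0 < (ν t).real {0} := by
          rw [measureReal_def]
          exact ENNReal.toReal_pos hne (measure_ne_top _ _)
        have hb : ∀ l : ℝ, 0 ≤ l → (ν t).real {0} ≤ Real.exp (-(t * ψ l)) := by
          intro l hl
          rw [← hνlap t ht l hl]
          calc (ν t).real {0} = ∫ s, Set.indicator {0} (fun _ => (1:ℝ)) s ∂(ν t) := by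
                rw [integral_indicator_const _ (measurableSet_singleton 0)]; simp
            _ ≤ _ := by
                refine integral_mono ((integrable_const _).indicator (measurableSet_singleton 0))
                  (hνi t ht l hl) ?_
                intro s
                by_cases hs : s = 0
                · simp [hs]
                · simpa [hs] using (Real.exp_pos _).le
        have hψb : ∀ l : ℝ, 0 ≤ l → ψ l ≤ - Real.log ((ν t).real {0}) / t := by
          intro l hl
          have := (Real.log_le_iff_le_exp hp).2 (hb l hl)
          rw [le_div_iff₀ ht]
          linarith
        have := aux_markov ρ (ENNReal.ofReal (- Real.log ((ν t).real {0}) / t)) (by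
          intro n
          rw [hψof n (Nat.cast_nonneg n)]
          exact ENNReal.ofReal_le_ofReal (hψb n (Nat.cast_nonneg n)))
        rw [hinf, ENNReal.mul_top hc0] at this
        exact ENNReal.ofReal_ne_top (top_le_iff.1 this)
      have hc2 : ν t (Set.Ioi 0)ᶜ = 0 := by
        have : (Set.Ioi (0:ℝ))ᶜ = Set.Iio 0 ∪ {0} := by
          ext x; simp [le_iff_lt_or_eq, or_comm]
        rw [this]
        exact measure_union_null (hνsupp t ht) hz
      exact (prob_compl_eq_zero_iff measurableSet_Ioi).1 hc2
    rw [h1, setLIntegral_congr_fun measurableSet_Ioi hone]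
    simp [hinf]
  · simp only [hinf, false_and, iff_false]
    have hfin : ρ Set.univ ≠ ⊤ := by
      rw [← Set.Iic_union_Ioi (a := (0:ℝ))]
      exact ((measure_union_le _ _).trans_lt (by
        rw [hρsupp, zero_add]; exact lt_top_iff_ne_top.2 hinf)).ne
    haveI : IsFiniteMeasure ρ := ⟨lt_top_iff_ne_top.2 hfin⟩
    set M := ρ.real Set.univ with hM
    have hM0 : 0 ≤ M := measureReal_nonneg
    have hψM : ∀ l : ℝ, 0 ≤ l → ψ l ≤ M := by
      intro l hl
      rw [hψ l hl]
      calc _ ≤ ∫ s, (1:ℝ) ∂ρ := by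
            refine integral_mono (hi l hl) (integrable_const _) ?_
            intro s
            have := Real.exp_pos (-(l * s))
            simp only
            linarith
        _ = M := by simp [hM]
    have hbd : ∀ t ∈ Set.Ioi (0:ℝ), ENNReal.ofReal (1 - Real.exp (-1)) * ν t (Set.Ioi 0)
        ≤ ENNReal.ofReal (M + 1) * ENNReal.ofReal (min t 1) := by
      intro t ht
      have ht : 0 < t := ht
      haveI := hνprob t ht
      apply aux_markov
      intro n
      have hn : (0:ℝ) ≤ n := Nat.cast_nonneg n
      have hsub : Integrable (fun s => 1 - Real.exp (-((n:ℝ) * s))) (ν t) :=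
        (integrable_const _).sub (hνi t ht n hn)
      rw [← ofReal_integral_eq_lintegral_ofReal hsub,
        integral_sub (integrable_const _) (hνi t ht n hn), hνlap t ht n hn,
        ← ENNReal.ofReal_mul (by positivity)]
      · apply ENNReal.ofReal_le_ofReal
        have e1 := Real.add_one_le_exp (-(t * ψ n))
        have e2 := Real.exp_pos (-(t * ψ n))
        have e3 := mul_le_mul_of_nonneg_left (hψM n hn) ht.le
        simp only [integral_const, probReal_univ, smul_eq_mul, mul_one]
        rcases min_cases t 1 with ⟨h, _⟩ | ⟨h, _⟩ <;> rw [h] <;> nlinarith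
      · have : ∀ᵐ s ∂(ν t), 0 ≤ s := by
          rw [ae_iff]
          simpa [Set.Iio] using hνsupp t ht
        filter_upwards [this] with s hs
        have : Real.exp (-((n:ℝ) * s)) ≤ 1 := Real.exp_le_one_iff.2 (by nlinarith)
        simpa using this
    intro htop
    have key : ENNReal.ofReal (1 - Real.exp (-1)) * ρ₁ (Set.Ioi 0) < ⊤ := by
      rw [h1, ← lintegral_const_mul _ (hνmeas _ measurableSet_Ioi)]
      calc _ ≤ ∫⁻ t in Set.Ioi (0:ℝ), ENNReal.ofReal (M + 1) * ENNReal.ofReal (min t 1) ∂ρ₀ :=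
            setLIntegral_mono' measurableSet_Ioi hbd
        _ ≤ ∫⁻ t, ENNReal.ofReal (M + 1) * ENNReal.ofReal (min t 1) ∂ρ₀ :=
            setLIntegral_le_lintegral _ _
        _ = ENNReal.ofReal (M + 1) * ∫⁻ t, ENNReal.ofReal (min t 1) ∂ρ₀ :=
            lintegral_const_mul' _ _ ENNReal.ofReal_ne_top
        _ < ⊤ := ENNReal.mul_lt_top ENNReal.ofReal_lt_top hρ₀int
    rw [htop, ENNReal.mul_top hc0] at key
    exact lt_irrefl _ key
end

section
/- Let d, k ≥ 1 and let n_{ij} ∈ ℕ for i = 1,…,d, j = 1,…,k, with column sums n_{∙j} = ∑_i n_{ij} ≥ 1 for every j. Let m_{∙j} = #{i : n_{ij} ≥ 1}, m = ∑_{j=1}^k m_{∙j}, and n = ∑_{i,j} n_{ij}. Let S(q₁,…,q_d; h) denote the coefficient of t^h in ∏_{i=1}^d ∏_{l=0}^{q_i−1}(t+l), and define, for m ≤ h ≤ n, c_h = ∑ ∏_{j=1}^k (h_j − 1)! · S(n_{1j},…,n_{dj}; h_j), where the sum runs over tuples (h₁,…,h_k) with h₁ + ⋯ + h_k = h and m_{∙j}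 ≤ h_j ≤ n_{∙j}. Then for every α₀ > 0 and t > 0: ∫_Δ (1 − ∑_{j=1}^k v_j)^{α₀−1} ∏_{j=1}^k [ v_j^{−1} ∏_{i=1}^d ∏_{l=0}^{n_{ij}−1}(t v_j + l) ] dv₁ ⋯ dv_k = Γ(α₀) ∑_{h=m}^{n} c_h t^h / Γ(α₀ + h), where Δ = {(v₁,…,v_k) ∈ (0,∞)^k : v₁ + ⋯ + v_k < 1}. -/
open MeasureTheory

lemma aux_beta_integral (e : ℕ) (b s : ℝ) (hb : 0 < b) (hs : 0 < s) :
    ∫ x in Set.Ioo 0 s, x ^ e * (s - x) ^ (b - 1)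
      = Nat.factorial e * Real.Gamma b / Real.Gamma (b + (e + 1)) * s ^ (b + (e + 1) - 1) := by
  have h1 := Complex.betaIntegral_scaled ((e + 1 : ℝ) : ℂ) (b : ℂ) hs
  have he : (0 : ℝ) < e + 1 := by positivity
  rw [Complex.betaIntegral_eq_Gamma_mul_div _ _ (by simpa using he) (by simpa using hb),
    ← Complex.ofReal_add, Complex.Gamma_ofReal, Complex.Gamma_ofReal, Complex.Gamma_ofReal,
    intervalIntegral.integral_of_le hs.le, ← integral_Ioc_eq_integral_Ioo] at *
  have h2 : ∫ x in Set.Ioc 0 s, (x : ℂ) ^ (((e + 1 : ℝ) : ℂ) - 1) * ((s : ℂ) - x) ^ ((b : ℂ) - 1)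
      = ∫ x in Set.Ioc 0 s, (((x ^ e * (s - x) ^ (b - 1) : ℝ)) : ℂ) := by
    refine setIntegral_congr_fun measurableSet_Ioc fun x hx => ?_
    rw [Complex.ofReal_mul, Complex.ofReal_cpow (sub_nonneg.2 hx.2)]
    push_cast
    simp
  rw [h2, integral_complex_ofReal] at h1
  have h3 : (s : ℂ) ^ (((e + 1 + b : ℝ) : ℂ) - 1) = ((s ^ (e + 1 + b - 1) : ℝ) : ℂ) := by
    rw [Complex.ofReal_cpow hs.le]; push_cast; rfl
  rw [h3] at h1
  have h4 : ∫ x in Set.Ioc 0 s, x ^ e * (s - x) ^ (b - 1) =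
    s ^ (e + 1 + b - 1) * (Real.Gamma (e + 1) * Real.Gamma b / Real.Gamma (e + 1 + b)) := by
    exact_mod_cast h1
  rw [h4, Real.Gamma_nat_eq_factorial, add_comm b]
  ring

lemma aux_beta_lintegral (e : ℕ) (b s : ℝ) (hb : 0 < b) (hs : 0 < s) :
    ∫⁻ x in Set.Ioo 0 s, ENNReal.ofReal (x ^ e * (s - x) ^ (b - 1))
      = ENNReal.ofReal (Nat.factorial e * Real.Gamma b / Real.Gamma (b + (e + 1)) *
          s ^ (b + (e + 1) - 1)) := by
  have h := aux_beta_integral e b s hb hs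
  rw [← h, ofReal_integral_eq_lintegral_ofReal]
  · refine not_imp_comm.1 integral_undef ?_
    rw [h]
    have := Real.Gamma_pos_of_pos hb
    have := Real.Gamma_pos_of_pos (show 0 < b + (e + 1) by positivity)
    positivity
  · filter_upwards [ae_restrict_mem measurableSet_Ioo] with x hx
    have := hx.1
    have := sub_pos.2 hx.2
    simp only [Pi.zero_apply]
    positivity

lemma aux_measSet (k : ℕ) (s : ℝ) :
    MeasurableSet {v : Fin k → ℝ | (∀ j, 0 < v j) ∧ ∑ j, v j < s} := by
  apply MeasurableSet.inter
  · have : {v : Fin k → ℝ | ∀ j, 0 < v j} = ⋂ j, {v | 0 < v j} := by ext; simp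
    change MeasurableSet {v : Fin k → ℝ | ∀ j, 0 < v j}
    rw [this]
    exact MeasurableSet.iInter fun j => measurableSet_lt measurable_const (measurable_pi_apply j)
  · have hf : Measurable (fun v : Fin k → ℝ => ∑ j, v j) := by fun_prop
    exact measurableSet_lt hf measurable_const

lemma aux_dirichlet_lintegral (α : ℝ) (hα : 0 < α) (k : ℕ) : ∀ (e : Fin k → ℕ) (s : ℝ), 0 < s →
    ∫⁻ v in {v : Fin k → ℝ | (∀ j, 0 < v j) ∧ ∑ j, v j < s},
      ENNReal.ofReal ((s - ∑ j, v j) ^ (α - 1) * ∏ j, v j ^ e j)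
      = ENNReal.ofReal (Real.Gamma α * (∏ j, (Nat.factorial (e j) : ℝ)) /
        Real.Gamma (α + ∑ j, ((e j : ℝ) + 1)) * s ^ (α + ∑ j, ((e j : ℝ) + 1) - 1)) := by
  induction k with
  | zero =>
    intro e s hs
    have := (Real.Gamma_pos_of_pos hα).ne'
    rw [Measure.volume_pi_eq_dirac, ← lintegral_indicator (aux_measSet 0 s), lintegral_dirac]
    simp [hs, this]
  | succ k ih =>
    intro e s hs
    set A := α + ∑ j : Fin k, ((e j.succ : ℝ) + 1) with hA
    have hApos : 0 < A := by positivity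
    set P := ∏ j : Fin k, (Nat.factorial (e j.succ) : ℝ) with hP
    have hPpos : 0 < P := by positivity
    rw [← lintegral_indicator (aux_measSet _ s),
      ← (volume_preserving_piFinSuccAbove (fun _ : Fin (k+1) => ℝ) 0).symm.lintegral_comp_emb
        (MeasurableEquiv.measurableEmbedding _)]
    have hmeas : Measurable ({v : Fin (k+1) → ℝ | (∀ j, 0 < v j) ∧ ∑ j, v j < s}.indicator
        fun v => ENNReal.ofReal ((s - ∑ j, v j) ^ (α - 1) * ∏ j, v j ^ e j)) := by
      refine Measurable.indicator ?_ (aux_measSet _ s)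
      fun_prop
    rw [show (volume : Measure (ℝ × (Fin k → ℝ))) = volume.prod volume from rfl]
    erw [lintegral_prod _
      (hmeas.comp (MeasurableEquiv.piFinSuccAbove
        (fun _ : Fin (k+1) => ℝ) 0).symm.measurable).aemeasurable]
    have key : ∀ x : ℝ, (∫⁻ w : Fin k → ℝ,
        ({v : Fin (k+1) → ℝ | (∀ j, 0 < v j) ∧ ∑ j, v j < s}.indicator
        fun v => ENNReal.ofReal ((s - ∑ j, v j) ^ (α - 1) * ∏ j, v j ^ e j))
          ((MeasurableEquiv.piFinSuccAbove (fun _ : Fin (k+1) => ℝ) 0).symm (x, w)))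
        = (Set.Ioo 0 s).indicator (fun x => ENNReal.ofReal (Real.Gamma α * P / Real.Gamma A) *
            ENNReal.ofReal (x ^ e 0 * (s - x) ^ (A - 1))) x := by
      intro x
      have hcons : ∀ w, (MeasurableEquiv.piFinSuccAbove (fun _ : Fin (k+1) => ℝ) 0).symm (x, w)
          = Fin.cons x w := by
        intro w
        simp [MeasurableEquiv.piFinSuccAbove, Fin.insertNthEquiv]
      simp only [hcons]
      by_cases hx : x ∈ Set.Ioo 0 s
      · have hsx : 0 < s - x := sub_pos.2 hx.2
        have hx0 := hx.1
        rw [Set.indicator_of_mem hx]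
        have h1 : ∀ w : Fin k → ℝ, ({v : Fin (k+1) → ℝ | (∀ j, 0 < v j) ∧ ∑ j, v j < s}.indicator
            fun v => ENNReal.ofReal ((s - ∑ j, v j) ^ (α - 1) * ∏ j, v j ^ e j))
            (Fin.cons x w : Fin (k+1) → ℝ)
            = ENNReal.ofReal (x ^ e 0) *
              ({v : Fin k → ℝ | (∀ j, 0 < v j) ∧ ∑ j, v j < s - x}.indicator
              fun v => ENNReal.ofReal ((s - x - ∑ j, v j) ^ (α - 1) * ∏ j, v j ^ e j.succ)) w := by
          intro w
          rw [Set.indicator_apply, Set.indicator_apply]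
          have hiff : (Fin.cons x w : Fin (k+1) → ℝ) ∈
              {v : Fin (k+1) → ℝ | (∀ j, 0 < v j) ∧ ∑ j, v j < s} ↔
              w ∈ {v : Fin k → ℝ | (∀ j, 0 < v j) ∧ ∑ j, v j < s - x} := by
            simp only [Set.mem_setOf_eq, Fin.forall_fin_succ, Fin.sum_univ_succ, Fin.cons_zero,
              Fin.cons_succ, hx0, true_and, lt_sub_iff_add_lt']
          by_cases hw : w ∈ {v : Fin k → ℝ | (∀ j, 0 < v j) ∧ ∑ j, v j < s - x}
          · rw [if_pos hw, if_pos (hiff.2 hw), ← ENNReal.ofReal_mul (by positivity)]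
            simp only [Fin.sum_univ_succ, Fin.prod_univ_succ, Fin.cons_zero, Fin.cons_succ]
            rw [sub_add_eq_sub_sub]
            congr 1
            ring
          · rw [if_neg hw, if_neg (mt hiff.1 hw), mul_zero]
        simp only [h1]
        rw [lintegral_const_mul' _ _ ENNReal.ofReal_ne_top, lintegral_indicator (aux_measSet _ _),
          ih (fun j => e j.succ) (s - x) hsx, ← hA, ← hP, ← ENNReal.ofReal_mul (by positivity),
          ← ENNReal.ofReal_mul]
        · congr 1
          ring
        · have := Real.Gamma_pos_of_pos hApos
          have := Real.Gamma_pos_of_pos hα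
          positivity
      · rw [Set.indicator_of_notMem hx]
        rw [lintegral_eq_zero_of_ae_eq_zero]
        filter_upwards with w
        rw [Set.indicator_of_notMem]
        · rfl
        · rintro ⟨h1, h2⟩
          apply hx
          have h3 : ∀ j : Fin k, 0 < w j := fun j => by simpa using h1 j.succ
          have h4 : 0 ≤ ∑ j, w j := Finset.sum_nonneg fun j _ => (h3 j).le
          rw [Fin.sum_univ_succ] at h2
          simp only [Fin.cons_zero, Fin.cons_succ] at h2
          refine ⟨by simpa using h1 0, by linarith⟩
    refine (lintegral_congr key).trans ?_
    have hGA := Real.Gamma_pos_of_pos hApos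
    have hGα := Real.Gamma_pos_of_pos hα
    rw [lintegral_indicator measurableSet_Ioo, lintegral_const_mul' _ _ ENNReal.ofReal_ne_top,
      aux_beta_lintegral _ _ _ hApos hs, ← ENNReal.ofReal_mul (by positivity),
      Fin.sum_univ_succ, Fin.prod_univ_succ, ← hP,
      show α + ((e 0 : ℝ) + 1 + ∑ j : Fin k, ((e j.succ : ℝ) + 1)) = A + (e 0 + 1) by
        rw [hA]; ring]
    congr 1
    field_simp

lemma aux_dirichlet (α : ℝ) (hα : 0 < α) (k : ℕ) (e : Fin k → ℕ) :
    IntegrableOn (fun v : Fin k → ℝ => (1 - ∑ j, v j) ^ (α - 1) * ∏ j, v j ^ e j)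
      {v : Fin k → ℝ | (∀ j, 0 < v j) ∧ ∑ j, v j < 1} ∧
    ∫ v in {v : Fin k → ℝ | (∀ j, 0 < v j) ∧ ∑ j, v j < 1},
      (1 - ∑ j, v j) ^ (α - 1) * ∏ j, v j ^ e j
      = Real.Gamma α * (∏ j, (Nat.factorial (e j) : ℝ)) /
        Real.Gamma (α + ∑ j, ((e j : ℝ) + 1)) := by
  have h := aux_dirichlet_lintegral α hα k e 1 one_pos
  have hm : Measurable (fun v : Fin k → ℝ => (1 - ∑ j, v j) ^ (α - 1) * ∏ j, v j ^ e j) := by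
    fun_prop
  have hnn : 0 ≤ᵐ[volume.restrict {v : Fin k → ℝ | (∀ j, 0 < v j) ∧ ∑ j, v j < 1}]
      (fun v : Fin k → ℝ => (1 - ∑ j, v j) ^ (α - 1) * ∏ j, v j ^ e j) := by
    filter_upwards [ae_restrict_mem (aux_measSet k 1)] with v hv
    have h1 := hv.1
    have h2 := sub_pos.2 hv.2
    have h3 : 0 ≤ ∏ j, v j ^ e j := Finset.prod_nonneg fun j _ => pow_nonneg (h1 j).le _
    simp only [Pi.zero_apply]
    positivity
  constructor
  · rw [IntegrableOn, ← lintegral_ofReal_ne_top_iff_integrable hm.aestronglyMeasurable hnn, h]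
    exact ENNReal.ofReal_ne_top
  · rw [integral_eq_lintegral_of_nonneg_ae hnn hm.aestronglyMeasurable, h, Real.one_rpow, mul_one,
      ENNReal.toReal_ofReal]
    have := Real.Gamma_pos_of_pos (show 0 < α + ∑ j, ((e j : ℝ) + 1) by positivity)
    have := Real.Gamma_pos_of_pos hα
    positivity

lemma aux_stirling (d : ℕ) (q : Fin d → ℕ) (s : ℕ → ℕ) 
    (hs : ∀ x : ℝ, (∏ i, ∏ l ∈ Finset.range (q i), (x + (l : ℝ))) =
        ∑ h ∈ Finset.range (∑ i, q i + 1), (s h : ℝ) * x ^ h)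
    (h : ℕ) (hle : h ≤ ∑ i, q i)
    (hlt : h < (Finset.univ.filter fun i : Fin d => 1 ≤ q i).card) : s h = 0 := by
  have hp : (∏ i, ∏ l ∈ Finset.range (q i), (Polynomial.X + Polynomial.C (l : ℝ))) =
      ∑ h ∈ Finset.range (∑ i, q i + 1), Polynomial.C (s h : ℝ) * Polynomial.X ^ h := by
    apply Polynomial.funext
    intro x
    simpa [Polynomial.eval_prod, Polynomial.eval_finset_sum] using hs x
  have hdvd : (Polynomial.X : Polynomial ℝ) ^ (Finset.univ.filter fun i : Fin d => 1 ≤ q i).card ∣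
      ∏ i, ∏ l ∈ Finset.range (q i), (Polynomial.X + Polynomial.C (l : ℝ)) := by
    rw [← Finset.prod_const, Finset.prod_filter]
    refine Finset.prod_dvd_prod_of_dvd _ _ fun i _ => ?_
    split_ifs with hi
    · have := Finset.dvd_prod_of_mem (fun l : ℕ => (Polynomial.X + Polynomial.C (l : ℝ)))
        (Finset.mem_range.2 (Nat.lt_of_lt_of_le Nat.zero_lt_one hi))
      simpa using this
    · exact one_dvd _
  have := Polynomial.X_pow_dvd_iff.1 hdvd h hlt
  rw [hp, Polynomial.finset_sum_coeff] at this
  simp only [Polynomial.coeff_C_mul, Polynomial.coeff_X_pow] at this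
  rw [Finset.sum_eq_single h] at this
  · simpa using this
  · intro b _ hb
    simp [hb.symm]
  · intro hh
    exact absurd (Finset.mem_range.2 (Nat.lt_succ_of_le hle)) hh



/-- (Proposition 12.) Marginalizing the simplex-valued auxiliary
vector: for counts `n i j` with positive column sums, with `S` the generalized
Stirling coefficients and `c h` the convolution coefficients, for all `α₀ > 0`
and `t > 0`,
`∫_Δ (1-∑ⱼvⱼ)^{α₀-1} ∏ⱼ [vⱼ⁻¹ ∏ᵢ ((t vⱼ))_{n i j}] dv = Γ(α₀) ∑_h c_h t^h / Γ(α₀+h)`. -/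
theorem simplex_marginalization
    (d k : ℕ) (hd : 1 ≤ d) (hk : 1 ≤ k)
    (n : Fin d → Fin k → ℕ) (hn : ∀ j, 1 ≤ ∑ i, n i j)
    (S : (Fin d → ℕ) → ℕ → ℕ)
    (hS : ∀ (q : Fin d → ℕ) (x : ℝ),
      (∏ i, ∏ l ∈ Finset.range (q i), (x + (l : ℝ))) =
        ∑ h ∈ Finset.range (∑ i, q i + 1), (S q h : ℝ) * x ^ h)
    (hSvanish : ∀ (q : Fin d → ℕ) (h : ℕ), ∑ i, q i < h → S q h = 0)
    (mcol : Fin k → ℕ)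
    (hmcol : ∀ j, mcol j = (Finset.univ.filter fun i : Fin d => 1 ≤ n i j).card)
    (ncol : Fin k → ℕ) (hncol : ∀ j, ncol j = ∑ i, n i j)
    (m N : ℕ) (hm : m = ∑ j, mcol j) (hN : N = ∑ i, ∑ j, n i j)
    (c : ℕ → ℝ)
    (hc : ∀ h : ℕ, c h = ∑ hv ∈ Finset.filter (fun hv => ∑ j, hv j = h)
        (Fintype.piFinset fun j => Finset.Icc (mcol j) (ncol j)),
        ∏ j, ((Nat.factorial (hv j - 1) : ℝ) * (S (fun i => n i j) (hv j) : ℝ)))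
    (α₀ t : ℝ) (hα₀ : 0 < α₀) (ht : 0 < t) :
    (∫ v in {v : Fin k → ℝ | (∀ j, 0 < v j) ∧ ∑ j, v j < 1},
        (1 - ∑ j, v j) ^ (α₀ - 1) *
          ∏ j, ((v j)⁻¹ * ∏ i, ∏ l ∈ Finset.range (n i j), (t * v j + (l : ℝ))))
      = Real.Gamma α₀ * ∑ h ∈ Finset.Icc m N, c h * t ^ h / Real.Gamma (α₀ + h) := by
  have hmpos : ∀ j, 1 ≤ mcol j := by
    intro j
    rw [hmcol, Nat.one_le_iff_ne_zero, Finset.card_ne_zero]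
    by_contra hne
    rw [Finset.not_nonempty_iff_eq_empty, Finset.filter_eq_empty_iff] at hne
    have : ∑ i, n i j = 0 := Finset.sum_eq_zero fun i _ => by
      have := hne (Finset.mem_univ i)
      omega
    have := hn j
    omega
  have hexp : ∀ (j : Fin k) (x : ℝ), 0 < x →
      x⁻¹ * ∏ i, ∏ l ∈ Finset.range (n i j), (t * x + (l : ℝ)) =
      ∑ h ∈ Finset.Icc (mcol j) (ncol j),
        ((S (fun i => n i j) h : ℝ) * t ^ h) * x ^ (h - 1) := by
    intro j x hx
    rw [hS (fun i => n i j) (t * x), Finset.mul_sum]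
    symm
    have hsub : Finset.Icc (mcol j) (ncol j) ⊆ Finset.range (∑ i, n i j + 1) := by
      intro h hh
      rw [Finset.mem_Icc, hncol] at hh
      exact Finset.mem_range.2 (Nat.lt_succ_of_le hh.2)
    rw [← Finset.sum_subset hsub]
    · refine Finset.sum_congr rfl fun h hh => ?_
      have h1 : 1 ≤ h := (hmpos j).trans (Finset.mem_Icc.1 hh).1
      obtain ⟨h', rfl⟩ := Nat.exists_eq_add_of_le' h1
      rw [Nat.add_sub_cancel, mul_pow, pow_succ x]
      field_simp
    · intro h hh hnot
      have hle : h ≤ ∑ i, n i j := Nat.le_of_lt_succ (Finset.mem_range.1 hh)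
      rw [Finset.mem_Icc, hncol, hmcol] at hnot
      rw [aux_stirling d (fun i => n i j) (S fun i => n i j) (hS _) h hle (by omega)]
      simp
  have hint : ∀ v ∈ {v : Fin k → ℝ | (∀ j, 0 < v j) ∧ ∑ j, v j < 1},
      (1 - ∑ j, v j) ^ (α₀ - 1) *
          ∏ j, ((v j)⁻¹ * ∏ i, ∏ l ∈ Finset.range (n i j), (t * v j + (l : ℝ))) =
      ∑ hv ∈ Fintype.piFinset fun j => Finset.Icc (mcol j) (ncol j),
        (∏ j, ((S (fun i => n i j) (hv j) : ℝ) * t ^ hv j)) *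
          ((1 - ∑ j, v j) ^ (α₀ - 1) * ∏ j, v j ^ (hv j - 1)) := by
    intro v hv
    rw [Finset.prod_congr rfl fun j _ => hexp j (v j) (hv.1 j), Finset.prod_univ_sum,
      Finset.mul_sum]
    refine Finset.sum_congr rfl fun hv _ => ?_
    rw [Finset.prod_mul_distrib]
    ring
  rw [setIntegral_congr_fun (aux_measSet k 1) hint, integral_finsetSum]
  swap
  · intro hv _
    exact (aux_dirichlet α₀ hα₀ k fun j => hv j - 1).1.const_mul _
  have hmaps : ∀ hv ∈ Fintype.piFinset fun j => Finset.Icc (mcol j) (ncol j),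
      ∑ j, hv j ∈ Finset.Icc m N := by
    intro hv hh
    rw [Fintype.mem_piFinset] at hh
    rw [Finset.mem_Icc, hm, hN, Finset.sum_comm]
    refine ⟨Finset.sum_le_sum fun j _ => (Finset.mem_Icc.1 (hh j)).1,
      Finset.sum_le_sum fun j _ => ?_⟩
    rw [← hncol]
    exact (Finset.mem_Icc.1 (hh j)).2
  rw [← Finset.sum_fiberwise_of_maps_to hmaps, Finset.mul_sum]
  refine Finset.sum_congr rfl fun h _ => ?_
  rw [hc, Finset.sum_mul, Finset.sum_div, Finset.mul_sum]
  refine Finset.sum_congr rfl fun hv hh => ?_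
  rw [Finset.mem_filter, Fintype.mem_piFinset] at hh
  obtain ⟨hmem, rfl⟩ := hh
  rw [integral_const_mul, (aux_dirichlet α₀ hα₀ k fun j => hv j - 1).2]
  have hsum : ∑ j, (((hv j - 1 : ℕ) : ℝ) + 1) = ((∑ j, hv j : ℕ) : ℝ) := by
    rw [Nat.cast_sum]
    refine Finset.sum_congr rfl fun j _ => ?_
    rw [Nat.cast_sub ((hmpos j).trans (Finset.mem_Icc.1 (hmem j)).1)]
    simp
  rw [hsum, Finset.prod_mul_distrib, Finset.prod_mul_distrib, Finset.prod_pow_eq_pow_sum]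
  ring
end

section
/- Let α, α₀ > 0 and let γ_a(s) = s^{a−1} e^{−s} / Γ(a) for s > 0 denote the gamma density with shape a > 0 and unit rate. Define the marginal Lévy density ρ₁(s) = ∫_0^∞ γ_{αt}(s) · α₀ e^{−t} t^{−1} dt and the bivariate Lévy density ρ₂(s₁,s₂) = ∫_0^∞ γ_{αt}(s₁) γ_{αt}(s₂) · α₀ e^{−t} t^{−1} dt. Then: (i) ∫_0^∞ s ρ₁(s) ds = α₀ α; (ii) ∫_0^∞ s² ρ₁(s) ds = α₀ α (1 + α); (iii) ∫_0^∞ ∫_0^∞ s₁ s₂ ρ₂(s₁,s₂) ds₁ ds₂ = α₀ α². In particular, the ratio (iii)/(ii) equals α/(1+α). -/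
open MeasureTheory

/-- The density of the gamma distribution with shape `a > 0` and unit rate:
`γ_a(s) = s^{a-1} e^{-s} / Γ(a)` for `s > 0`. -/
noncomputable def gammaDensity1 (a s : ℝ) : ℝ :=
  s ^ (a - 1) * Real.exp (-s) / Real.Gamma a

lemma gd_cont (α : ℝ) (hα : 0 < α) (n : ℕ) : ContinuousOn
    (fun p : ℝ × ℝ => p.1 ^ n * gammaDensity1 (α * p.2) p.1)
    (Set.Ioi 0 ×ˢ Set.Ioi 0) := by
  unfold gammaDensity1
  have hG : ContinuousOn (fun p : ℝ × ℝ => Real.Gamma (α * p.2)) (Set.Ioi 0 ×ˢ Set.Ioi 0) := by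
    intro p hp
    have h2 : 0 < α * p.2 := mul_pos hα hp.2
    have : ContinuousAt Real.Gamma (α * p.2) := by
      apply (Real.differentiableAt_Gamma _).continuousAt
      intro m
      have : (0:ℝ) ≤ m := Nat.cast_nonneg m
      linarith
    exact (ContinuousAt.comp (f := fun p : ℝ × ℝ => α * p.2) this
      (by fun_prop)).continuousWithinAt
  apply ContinuousOn.mul (by fun_prop)
  apply ContinuousOn.div _ hG
  · intro p hp
    exact (Real.Gamma_pos_of_pos (mul_pos hα hp.2)).ne'
  · apply ContinuousOn.mul _ (by fun_prop)
    apply ContinuousOn.rpow (by fun_prop) (by fun_prop)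
    intro p hp
    exact Or.inl (ne_of_gt hp.1)

lemma gd_nonneg {a s : ℝ} (ha : 0 < a) (hs : 0 < s) : 0 ≤ gammaDensity1 a s := by
  unfold gammaDensity1
  have := Real.Gamma_pos_of_pos ha
  positivity

lemma gd_eq (a : ℝ) (n : ℕ) {s : ℝ} (hs : 0 < s) :
    s ^ n * gammaDensity1 a s = (Real.exp (-s) * s ^ (a + n - 1)) / Real.Gamma a := by
  unfold gammaDensity1
  rw [show a + n - 1 = (a - 1) + n by ring, Real.rpow_add hs, Real.rpow_natCast]
  ring

lemma gd_integrable {a : ℝ} (ha : 0 < a) (n : ℕ) :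
    IntegrableOn (fun s => s ^ n * gammaDensity1 a s) (Set.Ioi 0) := by
  have h := (Real.GammaIntegral_convergent (s := a + n) (by positivity)).div_const (Real.Gamma a)
  exact IntegrableOn.congr_fun h (fun s hs => (gd_eq a n hs).symm) measurableSet_Ioi

lemma gd_integral {a : ℝ} (ha : 0 < a) (n : ℕ) :
    ∫ s in Set.Ioi (0:ℝ), s ^ n * gammaDensity1 a s = Real.Gamma (a + n) / Real.Gamma a := by
  rw [setIntegral_congr_fun measurableSet_Ioi (fun s hs => gd_eq a n hs), integral_div,
    Real.Gamma_eq_integral (s := a + n) (by positivity)]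

lemma gd_prod (α : ℝ) (hα : 0 < α) (n : ℕ) (m h : ℝ → ℝ)
    (hm : ∀ t, 0 < t → m t = Real.Gamma (α * t + n) / Real.Gamma (α * t))
    (hc : ContinuousOn h (Set.Ioi 0)) (h0 : ∀ t, 0 < t → 0 ≤ h t)
    (hi : IntegrableOn (fun t => m t * h t) (Set.Ioi 0)) :
    Integrable (fun p : ℝ × ℝ => p.1 ^ n * gammaDensity1 (α * p.2) p.1 * h p.2)
      ((volume.restrict (Set.Ioi 0)).prod (volume.restrict (Set.Ioi 0))) := by
  rw [integrable_prod_iff']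
  · constructor
    · refine (ae_restrict_iff' measurableSet_Ioi).2 (Filter.Eventually.of_forall fun t ht => ?_)
      exact (gd_integrable (mul_pos hα ht) n).mul_const (h t)
    · refine IntegrableOn.congr_fun hi (fun t ht => ?_) measurableSet_Ioi
      have ht' : 0 < t := ht
      simp only
      rw [setIntegral_congr_fun (g := fun s => s ^ n * gammaDensity1 (α * t) s * h t)
        measurableSet_Ioi, integral_mul_const, gd_integral (mul_pos hα ht), hm t ht]
      intro s hs
      have hs' : 0 < s := hs
      have := gd_nonneg (mul_pos hα ht) hs
      have := h0 t ht
      exact Real.norm_of_nonneg (by positivity)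
  · rw [Measure.prod_restrict]
    apply ContinuousOn.aestronglyMeasurable _ (measurableSet_Ioi.prod measurableSet_Ioi)
    exact (gd_cont α hα n).mul (hc.comp continuousOn_snd fun p hp => hp.2)

lemma gd_swap (α : ℝ) (hα : 0 < α) (n : ℕ) (m h : ℝ → ℝ)
    (hm : ∀ t, 0 < t → m t = Real.Gamma (α * t + n) / Real.Gamma (α * t))
    (hc : ContinuousOn h (Set.Ioi 0)) (h0 : ∀ t, 0 < t → 0 ≤ h t)
    (hi : IntegrableOn (fun t => m t * h t) (Set.Ioi 0)) :
    ∫ s in Set.Ioi (0:ℝ), s ^ n * ∫ t in Set.Ioi (0:ℝ), gammaDensity1 (α * t) s * h t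
      = ∫ t in Set.Ioi (0:ℝ), m t * h t := by
  have := integral_integral_swap (f := fun s t => s ^ n * gammaDensity1 (α * t) s * h t)
    (gd_prod α hα n m h hm hc h0 hi)
  simp_rw [← integral_const_mul, ← mul_assoc]
  rw [this]
  refine setIntegral_congr_fun measurableSet_Ioi fun t ht => ?_
  rw [integral_mul_const, gd_integral (mul_pos hα ht), hm t ht]

lemma ga_one {a : ℝ} (ha : 0 < a) : a = Real.Gamma (a + (1:ℕ)) / Real.Gamma a := by
  have := Real.Gamma_pos_of_pos ha
  rw [Nat.cast_one, Real.Gamma_add_one ha.ne']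
  field_simp

lemma ga_two {a : ℝ} (ha : 0 < a) : a * (a + 1) = Real.Gamma (a + (2:ℕ)) / Real.Gamma a := by
  have := Real.Gamma_pos_of_pos ha
  rw [show a + (2:ℕ) = (a + 1) + 1 by push_cast; ring, Real.Gamma_add_one (by positivity),
    Real.Gamma_add_one ha.ne']
  field_simp

lemma exp_int : IntegrableOn (fun t : ℝ => Real.exp (-t)) (Set.Ioi 0) ∧
    ∫ t in Set.Ioi (0:ℝ), Real.exp (-t) = 1 :=
  ⟨by simpa using Real.GammaIntegral_convergent (s := 1) one_pos, integral_exp_neg_Ioi_zero⟩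

lemma texp_int : IntegrableOn (fun t : ℝ => Real.exp (-t) * t) (Set.Ioi 0) ∧
    ∫ t in Set.Ioi (0:ℝ), Real.exp (-t) * t = 1 := by
  have h := Real.GammaIntegral_convergent (s := 2) two_pos
  have h2 := Real.Gamma_eq_integral (s := 2) two_pos
  norm_num at h h2
  exact ⟨h, h2.symm⟩

/-- Moments of the gamma–gamma hierarchical CRV (with unit
rates): with `ρ₁(s) = ∫₀^∞ γ_{αt}(s) α₀ e^{-t} t⁻¹ dt` and
`ρ₂(s₁,s₂) = ∫₀^∞ γ_{αt}(s₁) γ_{αt}(s₂) α₀ e^{-t} t⁻¹ dt`, one has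
`∫ s ρ₁ = α₀α`, `∫ s² ρ₁ = α₀α(1+α)`, `∫∫ s₁s₂ ρ₂ = α₀α²`, so the ratio of the
last two is `α/(1+α)`. -/
theorem gamma_gamma_moments
    (α α₀ : ℝ) (hα : 0 < α) (hα₀ : 0 < α₀)
    (ρ₁ : ℝ → ℝ)
    (hρ₁ : ∀ s : ℝ, ρ₁ s =
      ∫ t in Set.Ioi (0:ℝ), gammaDensity1 (α * t) s * (α₀ * Real.exp (-t) / t))
    (ρ₂ : ℝ → ℝ → ℝ)
    (hρ₂ : ∀ s₁ s₂ : ℝ, ρ₂ s₁ s₂ =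
      ∫ t in Set.Ioi (0:ℝ),
        gammaDensity1 (α * t) s₁ * gammaDensity1 (α * t) s₂ *
          (α₀ * Real.exp (-t) / t)) :
    (∫ s in Set.Ioi (0:ℝ), s * ρ₁ s) = α₀ * α ∧
    (∫ s in Set.Ioi (0:ℝ), s ^ 2 * ρ₁ s) = α₀ * α * (1 + α) ∧
    (∫ s₁ in Set.Ioi (0:ℝ), ∫ s₂ in Set.Ioi (0:ℝ), s₁ * s₂ * ρ₂ s₁ s₂)
      = α₀ * α ^ 2 ∧
    (∫ s₁ in Set.Ioi (0:ℝ), ∫ s₂ in Set.Ioi (0:ℝ), s₁ * s₂ * ρ₂ s₁ s₂) /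
        (∫ s in Set.Ioi (0:ℝ), s ^ 2 * ρ₁ s) = α / (1 + α) := by
  have hw : ContinuousOn (fun t : ℝ => α₀ * Real.exp (-t) / t) (Set.Ioi 0) :=
    ContinuousOn.div (by fun_prop) (by fun_prop) (fun t ht => ne_of_gt ht)
  have hw0 : ∀ t : ℝ, 0 < t → 0 ≤ α₀ * Real.exp (-t) / t := fun t ht => by positivity
  obtain ⟨e1, e2⟩ := exp_int
  obtain ⟨t1, t2⟩ := texp_int
  have m1 : ∀ t, 0 < t → α * t = Real.Gamma (α * t + (1:ℕ)) / Real.Gamma (α * t) :=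
    fun t ht => ga_one (mul_pos hα ht)
  have m2 : ∀ t, 0 < t → α * t * (α * t + 1) =
      Real.Gamma (α * t + (2:ℕ)) / Real.Gamma (α * t) :=
    fun t ht => ga_two (mul_pos hα ht)
  have E1 : Set.EqOn (fun t => α₀ * α * Real.exp (-t))
      (fun t => α * t * (α₀ * Real.exp (-t) / t)) (Set.Ioi 0) := by
    intro t ht
    have : t ≠ 0 := ne_of_gt ht
    simp only
    field_simp
  have E2 : Set.EqOn (fun t => α₀ * α * Real.exp (-t) + α₀ * α ^ 2 * (Real.exp (-t) * t))
      (fun t => α * t * (α * t + 1) * (α₀ * Real.exp (-t) / t)) (Set.Ioi 0) := by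
    intro t ht
    have : t ≠ 0 := ne_of_gt ht
    simp only
    field_simp
    ring
  have E3 : Set.EqOn (fun t => α₀ * α ^ 2 * (Real.exp (-t) * t))
      (fun t => α * t * (α * t * (α₀ * Real.exp (-t) / t))) (Set.Ioi 0) := by
    intro t ht
    have : t ≠ 0 := ne_of_gt ht
    simp only
    field_simp
  have A : (∫ s in Set.Ioi (0:ℝ), s * ρ₁ s) = α₀ * α := by
    have := gd_swap α hα 1 (fun t => α * t) _ m1 hw hw0
      (IntegrableOn.congr_fun (e1.const_mul _) E1 measurableSet_Ioi)
    rw [← setIntegral_congr_fun measurableSet_Ioi E1, integral_const_mul, e2, mul_one] at this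
    simpa only [hρ₁, pow_one] using this
  have B : (∫ s in Set.Ioi (0:ℝ), s ^ 2 * ρ₁ s) = α₀ * α * (1 + α) := by
    have := gd_swap α hα 2 (fun t => α * t * (α * t + 1)) _ m2 hw hw0
      (IntegrableOn.congr_fun ((e1.const_mul _).add (t1.const_mul _)) E2 measurableSet_Ioi)
    rw [← setIntegral_congr_fun measurableSet_Ioi E2,
      integral_add (e1.const_mul _) (t1.const_mul _),
      integral_const_mul, integral_const_mul, e2, t2] at this
    simp only [hρ₁]
    rw [this]
    ring
  have C : (∫ s₁ in Set.Ioi (0:ℝ), ∫ s₂ in Set.Ioi (0:ℝ), s₁ * s₂ * ρ₂ s₁ s₂)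
      = α₀ * α ^ 2 := by
    have hc' : ContinuousOn (fun t => α * t * (α₀ * Real.exp (-t) / t)) (Set.Ioi 0) :=
      ContinuousOn.mul (by fun_prop) hw
    have h0' : ∀ t : ℝ, 0 < t → 0 ≤ α * t * (α₀ * Real.exp (-t) / t) :=
      fun t ht => by positivity
    have hi' := IntegrableOn.congr_fun (t1.const_mul _) E3 measurableSet_Ioi
    have hP := gd_prod α hα 1 (fun t => α * t) _ m1 hc' h0' hi'
    have hS := gd_swap α hα 1 (fun t => α * t) _ m1 hc' h0' hi'
    rw [← setIntegral_congr_fun measurableSet_Ioi E3, integral_const_mul, t2, mul_one] at hS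
    rw [← hS]
    apply integral_congr_ae
    filter_upwards [hP.prod_right_ae, ae_restrict_mem measurableSet_Ioi] with s hs hs0
    have hs0' : 0 < s := hs0
    have hcs : ContinuousOn (fun t => s ^ 1 * gammaDensity1 (α * t) s * (α₀ * Real.exp (-t) / t))
        (Set.Ioi 0) := by
      refine ContinuousOn.mul ?_ hw
      exact (gd_cont α hα 1).comp (f := fun t : ℝ => (s, t)) (by fun_prop) fun t ht => ⟨hs0, ht⟩
    have := gd_swap α hα 1 (fun t => α * t) _ m1 hcs
      (fun t ht => by
        have := gd_nonneg (mul_pos hα ht) hs0'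
        have := hw0 t ht
        positivity)
      (hs.congr (Filter.Eventually.of_forall fun t => by simp only; ring))
    simp only [hρ₂]
    rw [← integral_const_mul]
    calc _ = _ := ?_
      _ = _ := this
      _ = _ := ?_
    · congr 1
      ext s2
      rw [← integral_const_mul, ← integral_const_mul]
      congr 1
      ext t
      ring
    · congr 1
      ext t
      ring
  refine ⟨A, B, C, ?_⟩
  rw [B, C]
  field_simp
end

section
/- Let α, α₀ > 0 and define ψ(u) = α log(1+u) and ψ₀(v) = α₀ log(1+v) for u, v ≥ 0, and the generalized exponential integral E_n(x) = ∫_1^∞ t^{−n} e^{−t x} dt for x > 0. Then: (i) −∫_0^∞ u e^{−ψ₀(u)} ψ₀''(u) du = 1/(1+α₀); and (ii) −∫_0^∞ u e^{−ψ₀(ψ(u))} [ ψ₀''(ψ(u)) ψ'(u)² + ψ₀'(ψ(u)) ψ''(u) ] du = (1 + (α₀/α) e^{1/α} E_{α₀}(1/α)) / (1 + α₀). -/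
open MeasureTheory Filter Topology

lemma aux_deriv (a u : ℝ) (hu : 0 < 1 + u) :
    deriv (fun v => a * Real.log (1 + v)) u = a / (1 + u) := by
  have h : HasDerivAt (fun v : ℝ => a * Real.log (1 + v)) (a * (1 / (1 + u))) u :=
    (((hasDerivAt_id u).const_add 1).log hu.ne').const_mul a
  rw [h.deriv]; ring

lemma aux_deriv2 (a u : ℝ) (hu : 0 < 1 + u) :
    deriv (deriv (fun v => a * Real.log (1 + v))) u = - a / (1 + u) ^ 2 := by
  have he : deriv (fun v => a * Real.log (1 + v)) =ᶠ[𝓝 u] fun v => a / (1 + v) := by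
    have : ∀ᶠ v in 𝓝 u, 0 < 1 + v :=
      (continuous_const.add continuous_id).continuousAt.eventually (lt_mem_nhds hu)
    filter_upwards [this] with v hv using aux_deriv a v hv
  rw [he.deriv_eq]
  have h : HasDerivAt (fun v : ℝ => a / (1 + v)) ((0 * (1 + u) - a * 1) / (1 + u) ^ 2) u :=
    (hasDerivAt_const u a).div ((hasDerivAt_id u).const_add 1) hu.ne'
  rw [h.deriv]; ring

lemma aux_exp (a u : ℝ) (hu : 0 < 1 + u) :
    Real.exp (-(a * Real.log (1 + u))) = (1 + u) ^ (-a) := by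
  rw [Real.rpow_def_of_pos hu]; ring_nf

lemma W_pos (α u : ℝ) (hα : 0 < α) (hu : 0 ≤ u) : 1 ≤ 1 + α * Real.log (1 + u) := by
  have := mul_nonneg hα.le (Real.log_nonneg (by linarith : (1:ℝ) ≤ 1 + u))
  linarith

lemma W_deriv (α u : ℝ) (hu : 0 ≤ u) :
    HasDerivAt (fun v : ℝ => 1 + α * Real.log (1 + v)) (α / (1 + u)) u := by
  have h : HasDerivAt (fun v : ℝ => 1 + α * Real.log (1 + v)) (α * (1 / (1 + u))) u :=
    ((((hasDerivAt_id u).const_add 1).log (by positivity)).const_mul α).const_add 1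
  convert h using 1; ring

lemma Wr_deriv (α u r : ℝ) (hα : 0 < α) (hu : 0 ≤ u) :
    HasDerivAt (fun v : ℝ => (1 + α * Real.log (1 + v)) ^ r)
      (r * (α / (1 + u)) * (1 + α * Real.log (1 + u)) ^ (r - 1)) u := by
  have h1 := W_pos α u hα hu
  have h := (W_deriv α u hu).rpow_const (p := r) (Or.inl (by positivity))
  convert h using 1; ring

lemma W_tendsto (α : ℝ) (hα : 0 < α) :
    Tendsto (fun v : ℝ => 1 + α * Real.log (1 + v)) atTop atTop :=
  tendsto_atTop_add_const_left _ _ ((Real.tendsto_log_atTop.comp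
    (tendsto_atTop_add_const_left _ 1 tendsto_id)).const_mul_atTop hα)

lemma Wr_tendsto (α a : ℝ) (hα : 0 < α) (ha : 0 < a) :
    Tendsto (fun v : ℝ => (1 + α * Real.log (1 + v)) ^ (-a)) atTop (𝓝 0) :=
  (tendsto_rpow_neg_atTop ha).comp (W_tendsto α hα)

lemma s_deriv (u : ℝ) (hu : 0 ≤ u) :
    HasDerivAt (fun v : ℝ => (1 + v)⁻¹) (-(1 / (1 + u) ^ 2)) u := by
  have h : HasDerivAt (fun v : ℝ => (1 + v)⁻¹) (-1 / (1 + u) ^ 2) u :=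
    ((hasDerivAt_id u).const_add 1).inv (by positivity)
  convert h using 1; ring

lemma s_tendsto : Tendsto (fun v : ℝ => (1 + v)⁻¹) atTop (𝓝 0) :=
  tendsto_inv_atTop_zero.comp (tendsto_atTop_add_const_left _ 1 tendsto_id)

lemma P_int (α a : ℝ) (hα : 0 < α) (ha : 0 < a) :
    IntegrableOn (fun u : ℝ => (1 + u)⁻¹ * (1 + α * Real.log (1 + u)) ^ (-a - 1)) (Set.Ioi 0) := by
  have h : IntegrableOn (fun u : ℝ => α * a * ((1 + u)⁻¹ * (1 + α * Real.log (1 + u)) ^ (-a - 1)))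
      (Set.Ioi 0) := by
    refine integrableOn_Ioi_deriv_of_nonneg'
      (g := fun u => - (1 + α * Real.log (1 + u)) ^ (-a)) (l := -0) ?_ ?_ ?_
    · intro u hu
      have := (Wr_deriv α u (-a) hα hu).neg
      refine HasDerivAt.congr_deriv this ?_
      rw [div_eq_mul_inv]; ring
    · intro u hu
      have hu : (0:ℝ) < u := hu
      have := W_pos α u hα hu.le
      positivity
    · exact (Wr_tendsto α a hα ha).neg
  have h2 := h.const_mul (α * a)⁻¹
  refine (integrableOn_congr_fun ?_ measurableSet_Ioi).mp h2
  intro u _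
  simp only
  field_simp

lemma Q_int (α b : ℝ) (hα : 0 < α) (hb : 0 ≤ b) :
    IntegrableOn (fun u : ℝ => 1 / (1 + u) ^ 2 * (1 + α * Real.log (1 + u)) ^ (-b)) (Set.Ioi 0) := by
  have h : IntegrableOn (fun u : ℝ => 1 / (1 + u) ^ 2) (Set.Ioi 0) := by
    refine integrableOn_Ioi_deriv_of_nonneg'
      (g := fun u => - (1 + u)⁻¹) (l := -0) ?_ ?_ s_tendsto.neg
    · intro u hu
      exact HasDerivAt.congr_deriv (s_deriv u hu).neg (neg_neg _)
    · intro u hu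
      positivity
  refine h.mono' (Measurable.aestronglyMeasurable (by fun_prop)) ?_
  refine (ae_restrict_iff' measurableSet_Ioi).2 (Eventually.of_forall fun u hu => ?_)
  have hu : (0:ℝ) < u := hu
  have h1 := W_pos α u hα hu.le
  rw [Real.norm_of_nonneg (by positivity)]
  exact mul_le_of_le_one_right (by positivity) (Real.rpow_le_one_of_one_le_of_nonpos h1 (by linarith))

lemma part1 (a : ℝ) (ha : 0 < a) :
    ∫ u in Set.Ioi (0:ℝ), u * (1 + u) ^ (-a) * (a / (1 + u) ^ 2) = 1 / (1 + a) := by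
  have hd : ∀ r : ℝ, ∀ u ∈ Set.Ici (0:ℝ), HasDerivAt (fun v : ℝ => (1 + v) ^ r)
      (1 * r * (1 + u) ^ (r - 1)) u := fun r u hu =>
    ((hasDerivAt_id u).const_add 1).rpow_const (Or.inl (by
      have : (0:ℝ) ≤ u := hu
      simp only [id]; positivity))
  have ht : ∀ r : ℝ, 0 < r → Tendsto (fun v : ℝ => (1 + v) ^ (-r)) atTop (𝓝 0) := fun r hr =>
    (tendsto_rpow_neg_atTop hr).comp (tendsto_atTop_add_const_left _ 1 tendsto_id)
  have := integral_Ioi_of_hasDerivAt_of_nonneg' (a := 0) (l := -0 + a / (1 + a) * 0)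
    (g := fun v : ℝ => -(1 + v) ^ (-a) + a / (1 + a) * (1 + v) ^ (-(a + 1)))
    (g' := fun u => u * (1 + u) ^ (-a) * (a / (1 + u) ^ 2)) ?_ ?_ ?_
  · rw [this]; simp; field_simp; ring
  · intro u hu
    have hu' : (0:ℝ) ≤ u := hu
    have hp : 0 < 1 + u := by linarith
    refine HasDerivAt.congr_deriv
      ((hd (-a) u hu).neg.add ((hd (-(a+1)) u hu).const_mul (a / (1 + a)))) ?_
    rw [show -(a + 1) - 1 = -a - 1 - 1 by ring]
    simp only [Real.rpow_sub_one hp.ne']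
    field_simp
    ring
  · intro u hu
    have hu : (0:ℝ) < u := hu
    positivity
  · exact (ht a ha).neg.add ((ht (a + 1) (by linarith)).const_mul _)

lemma subst_E (α a : ℝ) (hα : 0 < α) :
    Real.exp (1 / α) * ∫ t in Set.Ioi (1:ℝ), t ^ (-a) * Real.exp (-(t * (1 / α)))
      = α * ∫ u in Set.Ioi (0:ℝ), 1 / (1 + u) ^ 2 * (1 + α * Real.log (1 + u)) ^ (-a) := by
  have him : (fun u : ℝ => 1 + α * Real.log (1 + u)) '' Set.Ioi 0 = Set.Ioi 1 := by
    ext t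
    constructor
    · rintro ⟨u, hu, rfl⟩
      have hu : (0:ℝ) < u := hu
      have := mul_pos hα (Real.log_pos (by linarith : (1:ℝ) < 1 + u))
      simpa using this
    · intro ht
      have ht : 1 < t := ht
      refine ⟨Real.exp ((t - 1) / α) - 1, ?_, ?_⟩
      · have : 0 < (t - 1) / α := div_pos (by linarith) hα
        simpa using this
      · simp only [add_sub_cancel, Real.log_exp]
        field_simp
        ring
  have hinj : Set.InjOn (fun u : ℝ => 1 + α * Real.log (1 + u)) (Set.Ioi 0) := by
    intro x hx y hy hxy
    have hx : (0:ℝ) < x := hx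
    have hy : (0:ℝ) < y := hy
    have h1 : Real.log (1 + x) = Real.log (1 + y) := by
      have : α * Real.log (1 + x) = α * Real.log (1 + y) := by simpa using hxy
      exact mul_left_cancel₀ hα.ne' this
    have := Real.log_injOn_pos (Set.mem_Ioi.2 (by linarith)) (Set.mem_Ioi.2 (by linarith)) h1
    linarith
  rw [← him, integral_image_eq_integral_abs_deriv_smul measurableSet_Ioi
    (fun u hu => (W_deriv α u (le_of_lt hu)).hasDerivWithinAt) hinj,
    ← integral_const_mul, ← integral_const_mul]
  refine setIntegral_congr_fun measurableSet_Ioi fun u hu => ?_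
  have hu : (0:ℝ) < u := hu
  have he : Real.exp (-((1 + α * Real.log (1 + u)) * (1 / α))) =
      (Real.exp (1 / α))⁻¹ * (1 + u)⁻¹ := by
    rw [show -((1 + α * Real.log (1 + u)) * (1 / α)) = -(1/α) + -Real.log (1 + u) by
      field_simp; ring, Real.exp_add, Real.exp_neg, Real.exp_neg, Real.exp_log (by linarith)]
  simp only [smul_eq_mul]
  rw [he, abs_of_pos (by positivity)]
  have := (Real.exp_pos (1/α)).ne'
  field_simp

lemma part2 (α a : ℝ) (hα : 0 < α) (ha : 0 < a) :
    ∫ u in Set.Ioi (0:ℝ), u * (1 + α * Real.log (1 + u)) ^ (-a) *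
      (a / (1 + α * Real.log (1 + u)) ^ 2 * (α / (1 + u)) ^ 2 +
        a / (1 + α * Real.log (1 + u)) * (α / (1 + u) ^ 2))
      = (1 + a * ∫ u in Set.Ioi (0:ℝ), 1 / (1 + u) ^ 2 * (1 + α * Real.log (1 + u)) ^ (-a))
        / (1 + a) := by
  have hf : IntegrableOn (fun u : ℝ => u * (1 + α * Real.log (1 + u)) ^ (-a) *
      (a / (1 + α * Real.log (1 + u)) ^ 2 * (α / (1 + u)) ^ 2 +
        a / (1 + α * Real.log (1 + u)) * (α / (1 + u) ^ 2))) (Set.Ioi 0) := by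
    have h := (((P_int α (a+1) hα (by linarith)).const_mul (a * α ^ 2)).add
      ((P_int α a hα ha).const_mul (a * α))).sub
      (((Q_int α (a+2) hα (by linarith)).const_mul (a * α ^ 2)).add
      ((Q_int α (a+1) hα (by linarith)).const_mul (a * α)))
    refine (integrableOn_congr_fun ?_ measurableSet_Ioi).mp h
    intro u hu
    have hu : (0:ℝ) < u := hu
    have h1 : 0 < 1 + α * Real.log (1 + u) := by linarith [W_pos α u hα hu.le]
    simp only [Pi.add_apply, Pi.sub_apply]
    rw [show -(a + 1) - 1 = -a - 1 - 1 by ring, show -(a + 2) = -a - 1 - 1 by ring,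
      show -(a + 1) = -a - 1 by ring]
    simp only [Real.rpow_sub_one h1.ne']
    field_simp
    ring
  have hh := (Q_int α a hα ha.le).const_mul (a / (1 + a))
  have hsub := integral_sub hf hh
  have key := integral_Ioi_of_hasDerivAt_of_tendsto' (a := 0)
    (m := a * α / (1 + a) * (0 * 0 - 0) + (a / (1 + a) * (0 * 0) - 0))
    (f := fun v : ℝ => a * α / (1 + a) * ((1 + v)⁻¹ * (1 + α * Real.log (1 + v)) ^ (-(a + 1))
        - (1 + α * Real.log (1 + v)) ^ (-(a + 1)))
      + (a / (1 + a) * ((1 + v)⁻¹ * (1 + α * Real.log (1 + v)) ^ (-a))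
        - (1 + α * Real.log (1 + v)) ^ (-a))) ?_ (hf.sub hh) ?_
  · rw [integral_const_mul] at hsub
    have key' := hsub.symm.trans key
    simp only [add_zero, Real.log_one, mul_zero, Real.one_rpow, inv_one] at key'
    rw [sub_eq_iff_eq_add] at key'
    rw [key']
    field_simp
    ring
  · intro u hu
    have hu : (0:ℝ) ≤ u := hu
    have h1 : 0 < 1 + α * Real.log (1 + u) := by linarith [W_pos α u hα hu]
    have hs := s_deriv u hu
    have hA := Wr_deriv α u (-(a + 1)) hα hu
    have hB := Wr_deriv α u (-a) hα hu
    refine HasDerivAt.congr_deriv ((((hs.mul hA).sub hA).const_mul (a * α / (1 + a))).add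
      (((hs.mul hB).const_mul (a / (1 + a))).sub hB)) ?_
    simp only [Pi.sub_apply]
    rw [show -(a + 1) - 1 = -a - 1 - 1 by ring, show -(a + 1) = -a - 1 by ring]
    simp only [Real.rpow_sub_one h1.ne']
    field_simp
    ring
  · have tA := Wr_tendsto α (a + 1) hα (by linarith)
    have tB := Wr_tendsto α a hα ha
    exact (((s_tendsto.mul tA).sub tA).const_mul _).add
      (((s_tendsto.mul tB).const_mul _).sub tB)

/-- For the gamma Laplace exponents `ψ(u) = α log(1+u)` and
`ψ₀(v) = α₀ log(1+v)`, the variance/covariance integrals of the normalized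
gamma–gamma hierarchical CRV evaluate to
`-∫₀^∞ u e^{-ψ₀(u)} ψ₀''(u) du = 1/(1+α₀)` and
`-∫₀^∞ u e^{-ψ₀(ψ(u))} (ψ₀∘ψ)''(u) du = (1 + (α₀/α) e^{1/α} E_{α₀}(1/α))/(1+α₀)`,
with `E_n(x) = ∫₁^∞ t^{-n} e^{-tx} dt` the generalized exponential integral. -/
theorem gamma_gamma_normalized_moment_integrals
    (α α₀ : ℝ) (hα : 0 < α) (hα₀ : 0 < α₀)
    (ψ ψ₀ : ℝ → ℝ)
    (hψ : ψ = fun u => α * Real.log (1 + u))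
    (hψ₀ : ψ₀ = fun v => α₀ * Real.log (1 + v))
    (E : ℝ → ℝ → ℝ)
    (hE : ∀ nn x : ℝ, E nn x = ∫ t in Set.Ioi (1:ℝ), t ^ (-nn) * Real.exp (-(t * x))) :
    (-(∫ u in Set.Ioi (0:ℝ), u * Real.exp (-(ψ₀ u)) * deriv (deriv ψ₀) u)
        = 1 / (1 + α₀)) ∧
    (-(∫ u in Set.Ioi (0:ℝ), u * Real.exp (-(ψ₀ (ψ u))) *
          (deriv (deriv ψ₀) (ψ u) * (deriv ψ u) ^ 2 +
            deriv ψ₀ (ψ u) * deriv (deriv ψ) u))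
        = (1 + α₀ / α * Real.exp (1 / α) * E α₀ (1 / α)) / (1 + α₀)) := by
  subst hψ hψ₀
  refine ⟨?_, ?_⟩
  · rw [← part1 α₀ hα₀, ← integral_neg]
    refine setIntegral_congr_fun measurableSet_Ioi fun u hu => ?_
    have hu : (0:ℝ) < u := hu
    simp only
    rw [aux_deriv2 _ _ (by linarith), aux_exp _ _ (by linarith)]
    ring
  · rw [hE, mul_assoc, subst_E α α₀ hα, ← mul_assoc, div_mul_cancel₀ _ hα.ne',
      ← part2 α α₀ hα hα₀, ← integral_neg]
    refine setIntegral_congr_fun measurableSet_Ioi fun u hu => ?_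
    have hu : (0:ℝ) < u := hu
    have h1 : 0 < 1 + α * Real.log (1 + u) := by linarith [W_pos α u hα hu.le]
    simp only
    rw [aux_deriv2 _ _ h1, aux_deriv _ _ h1, aux_deriv2 _ _ (by linarith),
      aux_deriv _ _ (by linarith), aux_exp _ _ h1]
    ring
end

section
/- Let α₀ > 0, d ≥ 1, let n₁,…,n_d ≥ 1 be integers with n = ∑_i n_i, let m be an integer with d ≤ m ≤ n, and let c_m,…,c_n ≥ 0 with c_m > 0 and c_n > 0. Write ((x))_q = ∏_{l=0}^{q−1}(x+l) for the ascending factorial, and define for t > 0: R(t) = ( ∑_{h=m}^{n} (c_h/((α₀))_h) t^h ) / ∏_{i=1}^d ((t))_{n_i}. Then: (i) R(t)/t^{m−d} → (c_m/((α₀))_m) / ∏_{i=1}^d (n_i − 1)! as t → 0⁺; (ii) R(t) → c_n/((α₀))_n as t → ∞; and (iii) for every r with 0 ≤ r ≤ m − d, the function t ↦ t^{−r} R(t) is bounded on (0,∞). -/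
open Filter

/-- Asymptotics and boundedness of the rejection-sampling
Radon–Nikodym factor
`R(t) = (∑_{h=m}^{n} (c_h/((α₀))_h) t^h) / ∏ᵢ ((t))_{nᵢ}`:
(i) `R(t)/t^{m-d} → (c_m/((α₀))_m)/∏ᵢ (nᵢ-1)!` as `t → 0⁺`;
(ii) `R(t) → c_n/((α₀))_n` as `t → ∞`;
(iii) `t ↦ t^{-r} R(t)` is bounded on `(0,∞)` for every `0 ≤ r ≤ m-d`. -/
theorem rejection_factor_asymptotics
    (α₀ : ℝ) (hα₀ : 0 < α₀) (d : ℕ) (hd : 1 ≤ d)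
    (n : Fin d → ℕ) (hn : ∀ i, 1 ≤ n i)
    (m : ℕ) (hdm : d ≤ m) (hmn : m ≤ ∑ i, n i)
    (c : ℕ → ℝ) (hcnn : ∀ h, 0 ≤ c h)
    (hcm : 0 < c m) (hcN : 0 < c (∑ i, n i))
    (R : ℝ → ℝ)
    (hR : ∀ t : ℝ, R t =
      (∑ h ∈ Finset.Icc m (∑ i, n i),
          c h / (∏ l ∈ Finset.range h, (α₀ + (l : ℝ))) * t ^ h) /
        ∏ i, ∏ l ∈ Finset.range (n i), (t + (l : ℝ))) :
    Tendsto (fun t : ℝ => R t / t ^ (m - d)) (nhdsWithin 0 (Set.Ioi 0))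
        (nhds ((c m / ∏ l ∈ Finset.range m, (α₀ + (l : ℝ))) /
          ∏ i, (Nat.factorial (n i - 1) : ℝ))) ∧
    Tendsto R atTop
        (nhds (c (∑ i, n i) / ∏ l ∈ Finset.range (∑ i, n i), (α₀ + (l : ℝ)))) ∧
    ∀ r : ℝ, 0 ≤ r → r ≤ (m : ℝ) - (d : ℝ) →
      ∃ C : ℝ, ∀ t ∈ Set.Ioi (0:ℝ), |t ^ (-r) * R t| ≤ C := by
  classical
  set N := ∑ i, n i with hN
  set a : ℕ → ℝ := fun h => c h / ∏ l ∈ Finset.range h, (α₀ + (l : ℝ)) with ha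
  have ha0 : ∀ h, 0 ≤ a h := fun h =>
    div_nonneg (hcnn h) (Finset.prod_nonneg fun l _ => by positivity)
  set Q : ℝ → ℝ := fun t => ∏ i, ∏ l ∈ Finset.range (n i - 1), (t + ((l + 1 : ℕ) : ℝ)) with hQ
  have hden : ∀ t : ℝ, ∏ i, ∏ l ∈ Finset.range (n i), (t + (l : ℝ)) = t ^ d * Q t := by
    intro t
    have h1 : ∀ i, ∏ l ∈ Finset.range (n i), (t + (l : ℝ))
        = t * ∏ l ∈ Finset.range (n i - 1), (t + ((l + 1 : ℕ) : ℝ)) := by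
      intro i
      obtain ⟨k, hk⟩ := Nat.exists_eq_add_of_le' (hn i)
      rw [hk, Finset.prod_range_succ']
      simp [mul_comm]
    simp only [h1, hQ, Finset.prod_mul_distrib, Finset.prod_const, Finset.card_univ,
      Fintype.card_fin]
  have hQ0 : Q 0 = ∏ i, (Nat.factorial (n i - 1) : ℝ) := by
    simp only [hQ, zero_add]
    refine Finset.prod_congr rfl fun i _ => ?_
    rw [← Finset.prod_range_add_one_eq_factorial]
    push_cast
    rfl
  have hQc : Continuous Q := by
    simp only [hQ]
    fun_prop
  have hQ0' : Q 0 ≠ 0 := by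
    rw [hQ0]
    exact Finset.prod_ne_zero_iff.2 fun i _ => by positivity
  have hQ1 : ∀ t : ℝ, 0 < t → 1 ≤ Q t := by
    intro t ht
    have key : ∀ {ι : Type} (s : Finset ι) (f : ι → ℝ), (∀ x ∈ s, 1 ≤ f x) →
        1 ≤ ∏ x ∈ s, f x := by
      intro ι s f hf
      have := Finset.prod_le_prod (s := s) (f := fun _ => (1 : ℝ)) (g := f)
        (fun _ _ => zero_le_one) hf
      simpa using this
    refine key _ _ fun i _ => key _ _ fun l _ => ?_
    push_cast
    have : (0 : ℝ) ≤ l := Nat.cast_nonneg l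
    linarith
  have hpowN : ∀ t : ℝ, t ^ N = ∏ i, ∏ _l ∈ Finset.range (n i), t := by
    intro t
    simp [hN, Finset.prod_pow_eq_pow_sum]
  have hdenN : ∀ t : ℝ, 0 < t → t ^ N ≤ ∏ i, ∏ l ∈ Finset.range (n i), (t + (l : ℝ)) := by
    intro t ht
    rw [hpowN]
    refine Finset.prod_le_prod (fun i _ => Finset.prod_nonneg fun l _ => ht.le) fun i _ =>
      Finset.prod_le_prod (fun l _ => ht.le) fun l _ => ?_
    have : (0 : ℝ) ≤ l := Nat.cast_nonneg l
    linarith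
  refine ⟨?_, ?_, ?_⟩
  · set P : ℝ → ℝ := fun t => ∑ h ∈ Finset.Icc m N, a h * t ^ (h - m) with hP
    have hPc : Continuous P := by
      simp only [hP]
      fun_prop
    have hP0 : P 0 = a m := by
      simp only [hP]
      rw [Finset.sum_eq_single m]
      · simp
      · intro h hh hne
        have : h - m ≠ 0 := by
          have := (Finset.mem_Icc.1 hh).1
          omega
        simp [this]
      · intro h
        exact absurd (Finset.mem_Icc.2 ⟨le_rfl, hmn⟩) h
    have hlim : Tendsto (fun t => P t / Q t) (nhdsWithin 0 (Set.Ioi 0)) (nhds (P 0 / Q 0)) :=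
      ((hPc.tendsto 0).div (hQc.tendsto 0) hQ0').mono_left nhdsWithin_le_nhds
    rw [hP0, hQ0] at hlim
    refine hlim.congr' ?_
    filter_upwards [self_mem_nhdsWithin] with t ht
    have ht : 0 < t := ht
    have hnum : ∑ h ∈ Finset.Icc m N, a h * t ^ h = t ^ m * P t := by
      simp only [hP, Finset.mul_sum]
      refine Finset.sum_congr rfl fun h hh => ?_
      rw [mul_left_comm, ← pow_add, Nat.add_sub_cancel' (Finset.mem_Icc.1 hh).1]
    have hm : t ^ m = t ^ d * t ^ (m - d) := by
      rw [← pow_add, Nat.add_sub_cancel' hdm]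
    have hQt : Q t ≠ 0 := (zero_lt_one.trans_le (hQ1 t ht)).ne'
    rw [hR, hden, hnum, hm]
    field_simp
  · have h1 : Tendsto (fun t : ℝ => ∑ h ∈ Finset.Icc m N, a h * (t ^ h / t ^ N)) atTop
        (nhds (∑ h ∈ Finset.Icc m N, a h * (if h = N then 1 else 0))) := by
      refine tendsto_finsetSum _ fun h hh => Tendsto.const_mul _ ?_
      split_ifs with hh'
      · subst hh'
        refine tendsto_const_nhds.congr' ?_
        filter_upwards [eventually_gt_atTop 0] with t ht
        rw [div_self (by positivity)]
      · exact tendsto_pow_div_pow_atTop_zero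
          (lt_of_le_of_ne (Finset.mem_Icc.1 hh).2 hh')
    have h2 : Tendsto (fun t : ℝ => ∏ i, ∏ l ∈ Finset.range (n i), (1 + (l : ℝ) / t)) atTop
        (nhds (∏ i, ∏ l ∈ Finset.range (n i), (1 + 0))) := by
      refine tendsto_finsetProd _ fun i _ => tendsto_finsetProd _ fun l _ => ?_
      exact tendsto_const_nhds.add (tendsto_const_nhds.div_atTop tendsto_id)
    have h3 := h1.div h2 (by simp)
    have e : (∑ h ∈ Finset.Icc m N, a h * (if h = N then (1 : ℝ) else 0)) /
        (∏ i, ∏ l ∈ Finset.range (n i), ((1 : ℝ) + 0)) = a N := by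
      simp [hmn]
    rw [e] at h3
    refine h3.congr' ?_
    filter_upwards [eventually_gt_atTop 0] with t ht
    have e1 : ∏ i, ∏ l ∈ Finset.range (n i), (t + (l : ℝ))
        = t ^ N * ∏ i, ∏ l ∈ Finset.range (n i), (1 + (l : ℝ) / t) := by
      rw [hpowN, ← Finset.prod_mul_distrib]
      refine Finset.prod_congr rfl fun i _ => ?_
      rw [← Finset.prod_mul_distrib]
      refine Finset.prod_congr rfl fun l _ => ?_
      field_simp
    have e2 : ∑ h ∈ Finset.Icc m N, a h * (t ^ h / t ^ N)
        = (∑ h ∈ Finset.Icc m N, a h * t ^ h) / t ^ N := by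
      rw [Finset.sum_div]
      exact Finset.sum_congr rfl fun h _ => by rw [mul_div_assoc]
    rw [hR, e1, Pi.div_apply, e2, div_div]
  · intro r hr0 hr
    refine ⟨∑ h ∈ Finset.Icc m N, a h, fun t ht => ?_⟩
    have ht : 0 < t := ht
    have hD : 0 < ∏ i, ∏ l ∈ Finset.range (n i), (t + (l : ℝ)) :=
      lt_of_lt_of_le (by positivity) (hdenN t ht)
    have hnn : 0 ≤ ∑ h ∈ Finset.Icc m N, a h * t ^ h :=
      Finset.sum_nonneg fun h _ => mul_nonneg (ha0 h) (by positivity)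
    rw [hR, abs_of_nonneg (mul_nonneg (Real.rpow_nonneg ht.le _) (div_nonneg hnn hD.le)),
      ← mul_div_assoc, div_le_iff₀ hD, Finset.mul_sum, Finset.sum_mul]
    refine Finset.sum_le_sum fun h hh => ?_
    rw [mul_left_comm]
    refine mul_le_mul_of_nonneg_left ?_ (ha0 h)
    obtain ⟨hh1, hh2⟩ := Finset.mem_Icc.1 hh
    have hh1' : (m : ℝ) ≤ h := by exact_mod_cast hh1
    have hh2' : (h : ℝ) ≤ N := by exact_mod_cast hh2
    rw [← Real.rpow_natCast t h, ← Real.rpow_add ht]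
    rcases le_total t 1 with h1 | h1
    · calc t ^ (-r + (h : ℝ)) ≤ t ^ (d : ℝ) :=
            Real.rpow_le_rpow_of_exponent_ge ht h1 (by linarith)
        _ = t ^ d := Real.rpow_natCast t d
        _ ≤ _ := by
          rw [hden]
          exact le_mul_of_one_le_right (by positivity) (hQ1 t ht)
    · calc t ^ (-r + (h : ℝ)) ≤ t ^ (N : ℝ) :=
            Real.rpow_le_rpow_of_exponent_le h1 (by linarith)
        _ = t ^ N := Real.rpow_natCast t N
        _ ≤ _ := hdenN t ht
end

section
/- Let d ≥ 2. For parameters α, b, α₀, b₀ > 0, define Ψ_{α,b,α₀,b₀} : [0,∞)^d → [0,∞) by Ψ_{α,b,α₀,b₀}(λ₁,…,λ_d) = α₀ log( 1 + (α/b₀) ∑_{i=1}^d log(1 + λ_i/b) ). Then for two parameter sets (α,b,α₀,b₀) and (α',b',α₀',b₀'), the functions Ψ_{α,b,α₀,b₀} and Ψ_{α',b',α₀',b₀'} coincide on [0,∞)^d if and only if α₀ = α₀', b = b', and α/b₀ = α'/b₀'. -/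
theorem deriv_eq_aux {f g : ℝ → ℝ} {f' g' x : ℝ} (hx : 0 < x) (h : ∀ y, 0 < y → f y = g y)
    (hf : HasDerivAt f f' x) (hg : HasDerivAt g g' x) : f' = g' := by
  have e : f =ᶠ[nhds x] g := by
    filter_upwards [lt_mem_nhds hx] with y hy using h y hy
  exact (hf.congr_of_eventuallyEq e.symm).unique hg

theorem hasDerivAt_log_aux {b x : ℝ} (hb : 0 < b) (hx : 0 < x) :
    HasDerivAt (fun y => Real.log (1 + y / b)) (1 / (b + x)) x := by
  have h0 : (1 + x / b) ≠ 0 := by positivity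
  have h1 : HasDerivAt (fun y : ℝ => 1 + y / b) (1 / b) x :=
    ((hasDerivAt_id x).div_const b).const_add 1
  convert h1.log h0 using 1
  field_simp

theorem log_aux_pos {b x : ℝ} (hb : 0 < b) (hx : 0 < x) : 0 < Real.log (1 + x / b) :=
  Real.log_pos (by have : 0 < x / b := by positivity
                   linarith)

theorem one_dim_aux {a b c a' b' c' : ℝ} (ha : 0 < a) (hb : 0 < b) (hc : 0 < c)
    (ha' : 0 < a') (hb' : 0 < b') (hc' : 0 < c')
    (h : ∀ x, 0 < x → a * Real.log (1 + c * Real.log (1 + x / b)) =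
      a' * Real.log (1 + c' * Real.log (1 + x / b'))) : a = a' ∧ b = b' ∧ c = c' := by
  have H1 : ∀ x, 0 < x → a * c * ((1 + c' * Real.log (1 + x / b')) * (b' + x)) =
      a' * c' * ((1 + c * Real.log (1 + x / b)) * (b + x)) := by
    intro x hx
    have p := log_aux_pos hb hx
    have p' := log_aux_pos hb' hx
    have q : 1 + c * Real.log (1 + x / b) ≠ 0 := by positivity
    have q' : 1 + c' * Real.log (1 + x / b') ≠ 0 := by positivity
    have e := deriv_eq_aux hx h
      (((((hasDerivAt_log_aux hb hx).const_mul c).const_add 1).log q).const_mul a)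
      (((((hasDerivAt_log_aux hb' hx).const_mul c').const_add 1).log q').const_mul a')
    have r : b + x ≠ 0 := by positivity
    have r' : b' + x ≠ 0 := by positivity
    generalize Real.log (1 + x / b) = L at *
    generalize Real.log (1 + x / b') = L' at *
    field_simp at e
    linarith
  have H2 : ∀ x, 0 < x → a * c * (c' + (1 + c' * Real.log (1 + x / b'))) =
      a' * c' * (c + (1 + c * Real.log (1 + x / b))) := by
    intro x hx
    have e := deriv_eq_aux hx H1
      (((((hasDerivAt_log_aux hb' hx).const_mul c').const_add 1).mul
        ((hasDerivAt_id x).const_add b')).const_mul (a * c))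
      (((((hasDerivAt_log_aux hb hx).const_mul c).const_add 1).mul
        ((hasDerivAt_id x).const_add b)).const_mul (a' * c'))
    have r : b + x ≠ 0 := by positivity
    have r' : b' + x ≠ 0 := by positivity
    simp only [id] at e
    rw [mul_assoc c', mul_assoc c, one_div_mul_cancel r, one_div_mul_cancel r'] at e
    linarith
  have H3 : ∀ x, 0 < x → a * (b + x) = a' * (b' + x) := by
    intro x hx
    have e := deriv_eq_aux hx H2
      (((((hasDerivAt_log_aux hb' hx).const_mul c').const_add 1).const_add c').const_mul (a * c))
      (((((hasDerivAt_log_aux hb hx).const_mul c).const_add 1).const_add c).const_mul (a' * c'))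
    have r : b + x ≠ 0 := by positivity
    have r' : b' + x ≠ 0 := by positivity
    field_simp at e
    linarith
  have e1 := H3 1 one_pos
  have e2 := H3 2 two_pos
  have ea : a = a' := by linarith
  subst ea
  have eb : b = b' := by
    have := mul_left_cancel₀ ha.ne' e1
    linarith
  subst eb
  refine ⟨rfl, rfl, ?_⟩
  have e3 := H1 1 one_pos
  have : a * (b + 1) * (c - c') = 0 := by linarith
  have hne : a * (b + 1) ≠ 0 := by positivity
  have := (mul_eq_zero.mp this).resolve_left hne
  linarith

/-- Identifiability of the gamma–gamma hierarchical CRV: the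
multivariate Laplace exponents
`Ψ(λ) = α₀ log(1 + (α/b₀) ∑ᵢ log(1 + λᵢ/b))` for two parameter sets coincide on
`[0,∞)^d` (`d ≥ 2`) iff `α₀ = α₀'`, `b = b'`, and `α/b₀ = α'/b₀'`. -/
theorem gamma_gamma_identifiability
    (d : ℕ) (hd : 2 ≤ d)
    (α b α₀ b₀ α' b' α₀' b₀' : ℝ)
    (hα : 0 < α) (hb : 0 < b) (hα₀ : 0 < α₀) (hb₀ : 0 < b₀)
    (hα' : 0 < α') (hb' : 0 < b') (hα₀' : 0 < α₀') (hb₀' : 0 < b₀') :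
    (∀ lam : Fin d → ℝ, (∀ i, 0 ≤ lam i) →
        α₀ * Real.log (1 + α / b₀ * ∑ i, Real.log (1 + lam i / b)) =
          α₀' * Real.log (1 + α' / b₀' * ∑ i, Real.log (1 + lam i / b')))
      ↔ (α₀ = α₀' ∧ b = b' ∧ α / b₀ = α' / b₀') := by
  constructor
  · intro h
    refine one_dim_aux hα₀ hb (div_pos hα hb₀) hα₀' hb' (div_pos hα' hb₀') ?_
    intro x hx
    have i0 : Fin d := ⟨0, by omega⟩
    have key : ∀ b : ℝ, ∑ i : Fin d, Real.log (1 + (if i = i0 then x else 0) / b) =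
        Real.log (1 + x / b) := by
      intro b
      rw [Finset.sum_eq_single i0]
      · simp
      · intro j _ hj
        simp [hj]
      · simp
    have e := h (fun i => if i = i0 then x else 0) (fun i => by
      split_ifs
      · exact hx.le
      · exact le_rfl)
    simpa only [key] using e
  · rintro ⟨h1, h2, h3⟩ lam _
    rw [h1, h2, h3]
end
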